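/- arXiv:2502.08433 — 3 statements merged into one kernel-verified Lean document; each statement's English description precedes it below -/
import Mathlib

section
/- Let α ∈ ℂ with -1/2 ≤ Re α < 1/2 and set λ = sin(πα)/π. Then for every x > 0 with x ≠ 1, the integral ∫₀^∞ r₁(y;α)/(x+y) dy converges and r₁(x;α) = 1/(1+x) + λ ∫₀^∞ r₁(y;α)/(x+y) dy; that is, r₁(·;α) satisfies the Stieltjes equation with given function g(x) = 1/(1+x). -/
open MeasureTheory Set Asymptotics

noncomputable section

/-- `r₁(x;α)` from Dixon's resolvent kernels. -/
def r1 (α : ℂ) (x : ℝ) : ℂ :=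
  if α = -(1/2 : ℂ) then
    -(2 / (Real.pi : ℂ)) * ((x : ℂ) ^ ((1 : ℂ)/2) * (Real.log x : ℂ)) / (1 - (x : ℂ) ^ 2)
  else
    (1 / Complex.cos ((Real.pi : ℂ) * α)) *
      (((x : ℂ) ^ (-α) - (x : ℂ) ^ (α + 1)) / (1 - (x : ℂ) ^ 2))

def r2 (α : ℂ) (x : ℝ) : ℂ := -(1 / (x : ℂ)) * r1 (-α) x

def r3 (α : ℂ) (x : ℝ) : ℂ := (x : ℂ) ^ 2 * r2 α x

def R1 (α : ℂ) (x y : ℝ) : ℂ := (1 / (y : ℂ)) * r1 α (x / y)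
def R2 (α : ℂ) (x y : ℝ) : ℂ := (1 / (y : ℂ)) * r2 α (x / y)
def R3 (α : ℂ) (x y : ℝ) : ℂ := (1 / (y : ℂ)) * r3 α (x / y)

/-- membership in `E`: integrable on `(0,∞)` with weight `1/(1+x)`. -/
def MemE (f : ℝ → ℂ) : Prop :=
  IntegrableOn (fun x : ℝ => f x / (1 + (x : ℂ))) (Ioi 0)

/-- membership in `E_k`: integrable on `(0,∞)` with weight `x^{k-1}`. -/
def MemEk (k : ℝ) (f : ℝ → ℂ) : Prop :=
  IntegrableOn (fun x : ℝ => (x ^ (k - 1) : ℝ) • f x) (Ioi 0)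

/-- membership in `B_{ε,η}`. -/
def MemB (ε η : ℝ) (f : ℝ → ℂ) : Prop :=
  ContinuousOn f (Ioi 0) ∧
  ∃ M : ℝ, (∀ x : ℝ, 1 < x → x ^ ε * ‖f x‖ ≤ M) ∧ (∀ x : ℝ, 0 < x → x < 1 → x ^ η * ‖f x‖ ≤ M)

/-- the norm of `B_{ε,η}`. -/
def Bnorm (ε η : ℝ) (f : ℝ → ℂ) : ℝ :=
  sSup ((fun x : ℝ => x ^ ε * ‖f x‖) '' Ioi 1) + sSup ((fun x : ℝ => x ^ η * ‖f x‖) '' Ioo 0 1)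

/-- admissible weight pair `(φ₁,φ₂)`. -/
def AdmissiblePair (φ₁ φ₂ : ℝ → ℝ) : Prop :=
  ContinuousOn φ₁ (Ioi 0) ∧ ContinuousOn φ₂ (Ioi 0) ∧
  (∀ y : ℝ, 0 < y → (φ₁ y ∈ Ioo (0:ℝ) 1 ∧ φ₂ y ∈ Ioo (0:ℝ) 1 ∧ φ₁ y + φ₂ y = 1)) ∧
  φ₁ =O[Filter.atTop] (fun y : ℝ => 1 / y) ∧
  (fun y : ℝ => φ₁ y - 1) =O[nhdsWithin 0 (Ioi 0)] (fun y : ℝ => y)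

/-- the combined kernel `R₂₃`. -/
def R23 (φ₁ φ₂ : ℝ → ℝ) (α : ℂ) (x y : ℝ) : ℂ :=
  (φ₁ y : ℂ) * R2 α x y + (φ₂ y : ℂ) * R3 α x y


/-- Mellin data for a function that is bounded by a constant and decays like `t ^ (-a)`. -/
theorem mellin_regular_of_bound {f : ℝ → ℂ} {C a : ℝ} {s : ℂ} (hf : ContinuousOn f (Ioi 0))
    (hC : ∀ t : ℝ, 0 < t → ‖f t‖ ≤ C) (ha : ∀ t : ℝ, 0 < t → ‖f t‖ ≤ C * t ^ (-a))
    (hs0 : 0 < s.re) (hsa : s.re < a) :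
    MellinConvergent f s ∧ DifferentiableAt ℂ (mellin f) s := by
  have hloc : LocallyIntegrableOn f (Ioi 0) := hf.locallyIntegrableOn measurableSet_Ioi
  have htop : f =O[Filter.atTop] (fun t : ℝ => t ^ (-a)) := by
    refine IsBigO.of_bound C ?_
    filter_upwards [Filter.eventually_gt_atTop (0 : ℝ)] with t ht
    rw [Real.norm_of_nonneg (Real.rpow_nonneg ht.le _)]
    exact ha t ht
  have hbot : f =O[nhdsWithin 0 (Ioi 0)] (fun t : ℝ => t ^ (-(0 : ℝ))) := by
    refine IsBigO.of_bound C ?_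
    filter_upwards [self_mem_nhdsWithin] with t ht
    simpa using hC t ht
  exact ⟨mellinConvergent_of_isBigO_rpow hloc htop hsa hbot hs0,
    mellin_differentiableAt_of_isBigO_rpow hloc htop hsa hbot hs0⟩

theorem mellinConvergent_one_div_add {c : ℝ} (hc : 0 < c) {s : ℂ} (hs0 : 0 < s.re)
    (hs1 : s.re < 1) : MellinConvergent (fun t : ℝ => 1 / ((t : ℂ) + (c : ℂ))) s := by
  have hnorm : ∀ t : ℝ, 0 < t → ‖1 / ((t : ℂ) + (c : ℂ))‖ = 1 / (t + c) := by
    intro t ht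
    rw [← Complex.ofReal_add, norm_div, norm_one, Complex.norm_real,
      Real.norm_of_nonneg (by positivity)]
  refine (mellin_regular_of_bound (C := max 1 (1 / c)) (a := 1) ?_ ?_ ?_ hs0 hs1).1
  · refine ContinuousOn.div (by fun_prop) (by fun_prop) fun t ht => ?_
    have : 0 < t := ht
    exact_mod_cast (by positivity : t + c ≠ 0)
  · intro t ht
    rw [hnorm t ht]
    exact (one_div_le_one_div_of_le hc (by linarith)).trans (le_max_right _ _)
  · intro t ht
    rw [hnorm t ht, Real.rpow_neg_one, ← one_div]
    refine (one_div_le_one_div_of_le ht (by linarith)).trans ?_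
    exact le_mul_of_one_le_left (by positivity) (le_max_left _ _)

theorem image_div_one_add_Ioi : (fun t : ℝ => t / (1 + t)) '' Ioi 0 = Ioo 0 1 := by
  ext u
  constructor
  · rintro ⟨t, ht, rfl⟩
    have ht : 0 < t := ht
    refine ⟨by positivity, ?_⟩
    change t / (1 + t) < 1
    rw [div_lt_one (by positivity)]
    linarith
  · rintro ⟨h0, h1⟩
    have h : 0 < 1 - u := by linarith
    refine ⟨u / (1 - u), div_pos h0 h, ?_⟩
    have : 1 + u / (1 - u) ≠ 0 := by positivity
    simp only
    field_simp
    ring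

theorem mellin_one_div_add_one {s : ℂ} (hs0 : 0 < s.re) (hs1 : s.re < 1) :
    mellin (fun t : ℝ => 1 / ((t : ℂ) + 1)) s = Real.pi / Complex.sin (Real.pi * s) := by
  have hB := Complex.Gamma_mul_Gamma_eq_betaIntegral (s := s) (t := 1 - s) hs0 (by simpa using hs1)
  rw [Complex.Gamma_mul_Gamma_one_sub, add_sub_cancel, Complex.Gamma_one, one_mul] at hB
  rw [hB, Complex.betaIntegral, intervalIntegral.integral_of_le zero_le_one,
    integral_Ioc_eq_integral_Ioo, ← image_div_one_add_Ioi,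
    integral_image_eq_integral_abs_deriv_smul (f' := fun t => 1 / (1 + t) ^ 2) measurableSet_Ioi]
  · refine setIntegral_congr_fun measurableSet_Ioi fun t ht => ?_
    have ht : 0 < t := ht
    have h1 : 0 < 1 + t := by linarith
    have hc : (1 + t : ℂ) ≠ 0 := by exact_mod_cast h1.ne'
    have hq : (1 : ℂ) - ((t / (1 + t) : ℝ) : ℂ) = ((1 + t : ℝ) : ℂ)⁻¹ := by
      push_cast
      field_simp
      ring
    have hinv (z : ℂ) : (((1 + t : ℝ) : ℂ)⁻¹) ^ z = (((1 + t : ℝ) : ℂ) ^ z)⁻¹ := by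
      rw [Complex.inv_cpow]
      rw [Complex.arg_ofReal_of_nonneg h1.le]
      exact Real.pi_pos.ne
    simp only [smul_eq_mul]
    rw [hq, hinv, abs_of_pos (by positivity), div_eq_mul_inv t, Complex.ofReal_mul,
      Complex.mul_cpow_ofReal_nonneg ht.le (by positivity), Complex.ofReal_inv, hinv]
    have : ((1 + t : ℝ) : ℂ) ^ (s - 1) * ((1 + t : ℝ) : ℂ) ^ (1 - s - 1)
        = (((1 + t : ℝ) : ℂ))⁻¹ := by
      rw [← Complex.cpow_add _ _ (by exact_mod_cast h1.ne'), ← Complex.cpow_neg_one]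
      congr 1
      ring
    rw [mul_assoc, ← mul_inv, this, inv_inv, Complex.real_smul]
    push_cast
    rw [add_comm (t : ℂ) 1]
    field_simp
  · intro t ht
    have h1 : (1 + t) ≠ 0 := by
      have : 0 < t := ht
      positivity
    have := ((hasDerivAt_id t).div ((hasDerivAt_id t).const_add 1) h1).hasDerivWithinAt (s := Ioi 0)
    convert! this using 1
    simp
  · intro t ht u hu h
    have ht : 0 < t := ht
    have hu : 0 < u := hu
    have : t / (1 + t) = u / (1 + u) := h
    rw [div_eq_div_iff (by positivity) (by positivity)] at this
    linarith

theorem mellin_one_div_add {c : ℝ} (hc : 0 < c) {s : ℂ} (hs0 : 0 < s.re) (hs1 : s.re < 1) :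
    mellin (fun t : ℝ => 1 / ((t : ℂ) + (c : ℂ))) s
      = (c : ℂ) ^ (s - 1) * (Real.pi / Complex.sin (Real.pi * s)) := by
  have hc' : (c : ℂ) ≠ 0 := by exact_mod_cast hc.ne'
  have h := mellin_comp_mul_left (fun t : ℝ => 1 / ((t : ℂ) + (c : ℂ))) s hc
  have hfun : (fun t : ℝ => 1 / (((c * t : ℝ) : ℂ) + (c : ℂ)))
      = fun t : ℝ => (1 / ((t : ℂ) + 1)) / (c : ℂ) := by
    ext t
    rw [div_div]
    push_cast
    congr 1
    ring
  rw [hfun, mellin_div_const, mellin_one_div_add_one hs0 hs1, smul_eq_mul, Complex.cpow_neg] at h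
  have hne : (c : ℂ) ^ s ≠ 0 := by simp [Complex.cpow_eq_zero_iff, hc']
  rw [Complex.cpow_sub _ _ hc', Complex.cpow_one]
  rw [div_eq_iff hc', eq_comm] at h
  field_simp at h ⊢
  rw [h]

theorem eqOn_strip_of_eqOn_left {f g : ℂ → ℂ} {a b c : ℝ} (hab : a < b)
    (hbc : b < c) (hf : DifferentiableOn ℂ f {z | a < z.re ∧ z.re < c})
    (hg : DifferentiableOn ℂ g {z | a < z.re ∧ z.re < c})
    (h : ∀ z : ℂ, a < z.re → z.re < b → f z = g z) {z : ℂ} (hz1 : a < z.re) (hz2 : z.re < c) :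
    f z = g z := by
  have hopen (d : ℝ) : IsOpen {z : ℂ | a < z.re ∧ z.re < d} :=
    (isOpen_lt continuous_const Complex.continuous_re).inter
      (isOpen_lt Complex.continuous_re continuous_const)
  have hconv : Convex ℝ {z : ℂ | a < z.re ∧ z.re < c} :=
    (convex_halfSpace_re_gt a).inter (convex_halfSpace_re_lt c)
  obtain ⟨d, had, hdb⟩ := exists_between hab
  refine (hf.analyticOnNhd (hopen c)).eqOn_of_preconnected_of_eventuallyEq
    (hg.analyticOnNhd (hopen c)) hconv.isPreconnected (z₀ := (d : ℂ))
    ⟨by simpa using had, by simpa using hdb.trans hbc⟩ ?_ ⟨hz1, hz2⟩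
  filter_upwards [(hopen b).mem_nhds (x := (d : ℂ)) ⟨by simpa using had, by simpa using hdb⟩]
    with w hw using h w hw.1 hw.2

/-- The kernel whose Mellin transform is the function `r1`. -/
def pairKernel (y t : ℝ) : ℂ := 1 / ((1 + (y : ℂ) * (t : ℂ)) * ((t : ℂ) + (y : ℂ)))

theorem pairKernel_eq_ofReal (y t : ℝ) :
    pairKernel y t = ((1 / ((1 + y * t) * (t + y)) : ℝ) : ℂ) := by
  simp [pairKernel]

theorem mellin_pairKernel_regular {y : ℝ} (hy : 0 < y) {s : ℂ} (hs0 : 0 < s.re)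
    (hs2 : s.re < 2) :
    MellinConvergent (pairKernel y) s ∧ DifferentiableAt ℂ (mellin (pairKernel y)) s := by
  refine mellin_regular_of_bound (C := 1 / y) (a := 2) ?_ ?_ ?_ hs0 hs2
  · refine ContinuousOn.div (by fun_prop) (by fun_prop) fun t ht => ?_
    have : 0 < t := ht
    exact_mod_cast (by positivity : (1 + y * t) * (t + y) ≠ 0)
  · intro t ht
    rw [pairKernel_eq_ofReal, Complex.norm_real, Real.norm_of_nonneg (by positivity)]
    refine one_div_le_one_div_of_le hy ?_
    nlinarith [mul_pos hy ht, mul_pos (mul_pos hy ht) hy, mul_pos (mul_pos hy ht) ht]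
  · intro t ht
    rw [pairKernel_eq_ofReal, Complex.norm_real, Real.norm_of_nonneg (by positivity),
      Real.rpow_neg ht.le, Real.rpow_two, ← one_div, one_div_mul_one_div]
    refine one_div_le_one_div_of_le (by positivity) ?_
    nlinarith [mul_pos hy ht, mul_pos (mul_pos hy ht) hy, mul_pos (mul_pos hy ht) ht]

theorem sin_pi_mul_ne_zero_of_re_mem {s : ℂ} (hs0 : 0 ≤ s.re) (hs1 : s.re < 1) (hs : s ≠ 0) :
    Complex.sin (Real.pi * s) ≠ 0 := by
  refine sin_pi_mul_ne_zero ?_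
  rintro ⟨k, rfl⟩
  simp only [Complex.intCast_re] at hs0 hs1
  have h0 : 0 ≤ k := by exact_mod_cast hs0
  have h1 : k < 1 := by exact_mod_cast hs1
  have h2 : k = 0 := by omega
  exact hs (by simp [h2])

theorem sin_pi_mul_ne_zero_of_re_pos {s : ℂ} (hs0 : 0 < s.re) (hs1 : s.re < 1) :
    Complex.sin (Real.pi * s) ≠ 0 :=
  sin_pi_mul_ne_zero_of_re_mem hs0.le hs1 (by rintro rfl; simp at hs0)

theorem sin_mul_mellin_pairKernel {y : ℝ} (hy : 0 < y) (hy1 : y ≠ 1) {s : ℂ} (hs0 : 0 < s.re)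
    (hs2 : s.re < 2) :
    Complex.sin (Real.pi * s) * mellin (pairKernel y) s
      = Real.pi * ((y : ℂ) ^ (s - 1) - (y : ℂ) ^ (1 - s)) / (1 - (y : ℂ) ^ 2) := by
  have hyc : (y : ℂ) ≠ 0 := by exact_mod_cast hy.ne'
  have hy2 : 1 - (y : ℂ) ^ 2 ≠ 0 := by
    have : 1 - y ^ 2 ≠ 0 := by
      intro h
      have : (1 - y) * (1 + y) = 0 := by linarith
      rcases mul_eq_zero.1 this with h | h
      · exact hy1 (by linarith)
      · linarith
    exact_mod_cast this
  refine eqOn_strip_of_eqOn_left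
    (f := fun s => Complex.sin (Real.pi * s) * mellin (pairKernel y) s)
    (g := fun s => Real.pi * ((y : ℂ) ^ (s - 1) - (y : ℂ) ^ (1 - s)) / (1 - (y : ℂ) ^ 2))
    (a := 0) (b := 1) (c := 2) one_pos one_lt_two ?_ ?_ ?_ hs0 hs2
  · intro z hz
    exact ((by fun_prop : DifferentiableAt ℂ (fun s => Complex.sin (Real.pi * s)) z).mul
      (mellin_pairKernel_regular hy hz.1 hz.2).2).differentiableWithinAt
  · refine Differentiable.differentiableOn ?_
    have : NeZero (y : ℂ) := ⟨hyc⟩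
    fun_prop
  · intro z hz0 hz1
    have hyi : 0 < y⁻¹ := inv_pos.2 hy
    have hsub := hasMellin_sub (mellinConvergent_one_div_add hy hz0 hz1)
      (mellinConvergent_one_div_add hyi hz0 hz1)
    have hK : mellin (pairKernel y) z = mellin (fun t : ℝ => (1 / ((t : ℂ) + (y : ℂ))
        - 1 / ((t : ℂ) + ((y⁻¹ : ℝ) : ℂ))) / (1 - (y : ℂ) ^ 2)) z := by
      refine setIntegral_congr_fun measurableSet_Ioi fun t ht => ?_
      have ht : 0 < t := ht
      have h1 : (1 + (y : ℂ) * t) ≠ 0 := by exact_mod_cast (by positivity : 1 + y * t ≠ 0)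
      have h2 : ((t : ℂ) + y) ≠ 0 := by exact_mod_cast (by positivity : t + y ≠ 0)
      have h3 : (t : ℂ) + ((y⁻¹ : ℝ) : ℂ) = (1 + (y : ℂ) * t) / y := by
        push_cast
        field_simp
        ring
      simp only [pairKernel]
      rw [h3]
      congr 1
      field_simp
      ring
    have hsin := sin_pi_mul_ne_zero_of_re_pos hz0 hz1
    have hinv : ((y⁻¹ : ℝ) : ℂ) ^ (z - 1) = (y : ℂ) ^ (1 - z) := by
      rw [Complex.ofReal_inv, Complex.inv_cpow, ← Complex.cpow_neg, neg_sub]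
      rw [Complex.arg_ofReal_of_nonneg hy.le]
      exact Real.pi_pos.ne
    rw [hK, mellin_div_const, hsub.2, mellin_one_div_add hy hz0 hz1,
      mellin_one_div_add hyi hz0 hz1, hinv]
    field_simp

theorem mellin_pairKernel_one {y : ℝ} (hy : 0 < y) (hy1 : y ≠ 1) :
    mellin (pairKernel y) 1 = -2 * (Real.log y : ℂ) / (1 - (y : ℂ) ^ 2) := by
  have hyc : (y : ℂ) ≠ 0 := by exact_mod_cast hy.ne'
  have hpi : (Real.pi : ℂ) ≠ 0 := by exact_mod_cast Real.pi_ne_zero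
  have hK := (mellin_pairKernel_regular hy (s := 1) (by simp) (by simp)).2.hasDerivAt
  have hS : HasDerivAt (fun s : ℂ => Complex.sin (Real.pi * s))
      (Complex.cos (Real.pi * 1) * (Real.pi * 1)) 1 :=
    ((hasDerivAt_id (1 : ℂ)).const_mul (Real.pi : ℂ)).csin
  have hL := hS.mul hK
  have h1 : HasDerivAt (fun s : ℂ => (y : ℂ) ^ (s - 1))
      ((y : ℂ) ^ ((1 : ℂ) - 1) * Complex.log y * 1) 1 :=
    ((hasDerivAt_id (1 : ℂ)).sub_const 1).const_cpow (Or.inl hyc)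
  have h2 : HasDerivAt (fun s : ℂ => (y : ℂ) ^ (1 - s))
      ((y : ℂ) ^ ((1 : ℂ) - 1) * Complex.log y * (-1)) 1 :=
    ((hasDerivAt_id (1 : ℂ)).const_sub 1).const_cpow (Or.inl hyc)
  have hR := ((h1.sub h2).const_mul (Real.pi : ℂ)).div_const (1 - (y : ℂ) ^ 2)
  have heq : (fun s : ℂ => Complex.sin (Real.pi * s)) * mellin (pairKernel y)
      =ᶠ[nhds 1] fun s => Real.pi * ((y : ℂ) ^ (s - 1) - (y : ℂ) ^ (1 - s)) / (1 - (y : ℂ) ^ 2) := by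
    have hopen : IsOpen {z : ℂ | 0 < z.re ∧ z.re < 2} :=
      (isOpen_lt continuous_const Complex.continuous_re).inter
        (isOpen_lt Complex.continuous_re continuous_const)
    filter_upwards [hopen.mem_nhds (x := (1 : ℂ)) (by simp)] with z hz
    exact sin_mul_mellin_pairKernel hy hy1 hz.1 hz.2
  have := hL.unique (hR.congr_of_eventuallyEq heq)
  rw [mul_one, Complex.cos_pi, Complex.sin_pi, sub_self, Complex.cpow_zero,
    ← Complex.ofReal_log hy.le] at this
  have h3 : (Real.pi : ℂ) * mellin (pairKernel y) 1
      = Real.pi * (-2 * (Real.log y : ℂ) / (1 - (y : ℂ) ^ 2)) := by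
    linear_combination -this
  exact mul_left_cancel₀ hpi h3

theorem r1_eq_mellin_pairKernel {α : ℂ} (hα1 : -(1/2) ≤ α.re) (hα2 : α.re < 1/2) {y : ℝ}
    (hy : 0 < y) (hy1 : y ≠ 1) :
    r1 α y = (Real.sqrt y : ℂ) / Real.pi * mellin (pairKernel y) (α + 3/2) := by
  have hyc : (y : ℂ) ≠ 0 := by exact_mod_cast hy.ne'
  have hpi : (Real.pi : ℂ) ≠ 0 := by exact_mod_cast Real.pi_ne_zero
  have hsqrt : (Real.sqrt y : ℂ) = (y : ℂ) ^ (1 / 2 : ℂ) := by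
    rw [Real.sqrt_eq_rpow, Complex.ofReal_cpow hy.le]
    simp
  by_cases h : α = -(1/2 : ℂ)
  · have : α + 3/2 = 1 := by rw [h]; norm_num
    rw [r1, if_pos h, this, mellin_pairKernel_one hy hy1, hsqrt]
    ring
  · have hK := sin_mul_mellin_pairKernel hy hy1 (s := α + 3/2)
      (by norm_num; linarith) (by norm_num; linarith)
    have hcos : Complex.cos (Real.pi * α) ≠ 0 := by
      have := sin_pi_mul_ne_zero_of_re_mem (s := α + 1/2) (by norm_num; linarith)
        (by norm_num; linarith) (fun h0 => h (by linear_combination h0))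
      rwa [mul_add, ← mul_div_assoc, mul_one, Complex.sin_add_pi_div_two] at this
    have hsin : Complex.sin (Real.pi * (α + 3/2)) = -Complex.cos (Real.pi * α) := by
      rw [show (Real.pi : ℂ) * (α + 3/2) = (Real.pi * α + Real.pi / 2) + Real.pi by ring,
        Complex.sin_add_pi, Complex.sin_add_pi_div_two]
    have h1 : (y : ℂ) ^ (α + 1) = (y : ℂ) ^ (1 / 2 : ℂ) * (y : ℂ) ^ (α + 3/2 - 1) := by
      rw [← Complex.cpow_add _ _ hyc]
      congr 1
      ring
    have h2 : (y : ℂ) ^ (-α) = (y : ℂ) ^ (1 / 2 : ℂ) * (y : ℂ) ^ (1 - (α + 3/2)) := by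
      rw [← Complex.cpow_add _ _ hyc]
      congr 1
      ring
    rw [hsin] at hK
    have hM : mellin (pairKernel y) (α + 3/2) = -(1 / Complex.cos (Real.pi * α)) *
        (Real.pi * ((y : ℂ) ^ (α + 3/2 - 1) - (y : ℂ) ^ (1 - (α + 3/2))) / (1 - (y : ℂ) ^ 2)) := by
      rw [← hK]
      generalize mellin (pairKernel y) (α + 3/2) = M
      field_simp
    rw [r1, if_neg h, h1, h2, hM, hsqrt]
    field_simp
    ring

theorem integral_one_div_sqrt_mul_add {c : ℝ} (hc : 0 < c) :
    IntegrableOn (fun y : ℝ => 1 / (Real.sqrt y * (y + c ^ 2))) (Ioi 0) ∧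
      ∫ y in Ioi (0 : ℝ), 1 / (Real.sqrt y * (y + c ^ 2)) = Real.pi / c := by
  have hc2 : 0 < c ^ 2 := by positivity
  have hconv := mellinConvergent_one_div_add hc2 (s := 1/2) (by norm_num) (by norm_num)
  have hval := mellin_one_div_add hc2 (s := 1/2) (by norm_num) (by norm_num)
  have hEq : EqOn (fun t : ℝ => (t : ℂ) ^ ((1 : ℂ)/2 - 1) • (1 / ((t : ℂ) + ((c ^ 2 : ℝ) : ℂ))))
      (fun t : ℝ => ((1 / (Real.sqrt t * (t + c ^ 2)) : ℝ) : ℂ)) (Ioi 0) := by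
    intro t ht
    have ht : 0 < t := ht
    have : (t : ℂ) ^ ((1 : ℂ)/2 - 1) = ((Real.sqrt t : ℝ) : ℂ)⁻¹ := by
      rw [Real.sqrt_eq_rpow, Complex.ofReal_cpow ht.le, ← Complex.cpow_neg]
      congr 1
      push_cast
      ring
    simp only [this, smul_eq_mul]
    push_cast
    rw [one_div, one_div, mul_inv]
  rw [MellinConvergent, integrableOn_congr_fun hEq measurableSet_Ioi] at hconv
  refine ⟨hconv.re, ?_⟩
  rw [mellin, setIntegral_congr_fun measurableSet_Ioi hEq, integral_complex_ofReal] at hval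
  have hpow : ((c ^ 2 : ℝ) : ℂ) ^ ((1 : ℂ)/2 - 1) = (c : ℂ)⁻¹ := by
    have : ((1 : ℂ)/2 - 1) = ((-(1/2) : ℝ) : ℂ) := by
      push_cast
      ring
    rw [this, ← Complex.ofReal_cpow hc2.le, Real.rpow_neg hc2.le, ← Real.sqrt_eq_rpow,
      Real.sqrt_sq hc.le, Complex.ofReal_inv]
  have hs : Complex.sin (Real.pi * (1/2)) = 1 := by
    rw [← mul_div_assoc, mul_one, Complex.sin_pi_div_two]
  rw [hpow, hs] at hval
  have : ((∫ t in Ioi (0 : ℝ), 1 / (Real.sqrt t * (t + c ^ 2)) : ℝ) : ℂ)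
      = ((Real.pi / c : ℝ) : ℂ) := by
    rw [hval]
    push_cast
    ring
  exact_mod_cast this

theorem integral_sqrt_div_mul_mul {b c d : ℝ} (hb : 0 < b) (hc : 0 < c) (hd : 0 < d)
    (hbc : b ≠ c) (hcd : c ≠ d) (hbd : b ≠ d) :
    IntegrableOn (fun y : ℝ => Real.sqrt y / ((y + b ^ 2) * (y + c ^ 2) * (y + d ^ 2))) (Ioi 0) ∧
      ∫ y in Ioi (0 : ℝ), Real.sqrt y / ((y + b ^ 2) * (y + c ^ 2) * (y + d ^ 2))
        = Real.pi / ((b + c) * (c + d) * (b + d)) := by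
  have sq_sub_ne {u v : ℝ} (hu : 0 < u) (hv : 0 < v) (h : u ≠ v) : u ^ 2 - v ^ 2 ≠ 0 := by
    rw [sq_sub_sq]
    exact mul_ne_zero (by positivity) (sub_ne_zero.2 h)
  have h1 := sq_sub_ne hb hc hbc
  have h2 := sq_sub_ne hc hd hcd
  have h3 := sq_sub_ne hb hd hbd
  have h1' := sub_ne_zero.2 hbc
  have h2' := sub_ne_zero.2 hcd
  have h3' := sub_ne_zero.2 hbd
  obtain ⟨ib, vb⟩ := integral_one_div_sqrt_mul_add hb
  obtain ⟨ic, vc⟩ := integral_one_div_sqrt_mul_add hc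
  obtain ⟨id, vd⟩ := integral_one_div_sqrt_mul_add hd
  have jb := ib.const_mul (-b ^ 2 / ((b ^ 2 - c ^ 2) * (b ^ 2 - d ^ 2)))
  have jc := ic.const_mul (c ^ 2 / ((b ^ 2 - c ^ 2) * (c ^ 2 - d ^ 2)))
  have jd := id.const_mul (-d ^ 2 / ((b ^ 2 - d ^ 2) * (c ^ 2 - d ^ 2)))
  have hEq : EqOn (fun y : ℝ => Real.sqrt y / ((y + b ^ 2) * (y + c ^ 2) * (y + d ^ 2)))
      (fun y => -b ^ 2 / ((b ^ 2 - c ^ 2) * (b ^ 2 - d ^ 2)) * (1 / (Real.sqrt y * (y + b ^ 2)))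
        + c ^ 2 / ((b ^ 2 - c ^ 2) * (c ^ 2 - d ^ 2)) * (1 / (Real.sqrt y * (y + c ^ 2)))
        + -d ^ 2 / ((b ^ 2 - d ^ 2) * (c ^ 2 - d ^ 2)) * (1 / (Real.sqrt y * (y + d ^ 2))))
      (Ioi 0) := by
    intro y hy
    have hy : 0 < y := hy
    have hs : 0 < Real.sqrt y := Real.sqrt_pos.2 hy
    have hyb : y + b ^ 2 ≠ 0 := by positivity
    have hyc : y + c ^ 2 ≠ 0 := by positivity
    have hyd : y + d ^ 2 ≠ 0 := by positivity
    simp only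
    field_simp
    rw [Real.sq_sqrt hy.le]
    ring
  refine ⟨(integrableOn_congr_fun hEq measurableSet_Ioi).2 ((jb.add jc).add jd), ?_⟩
  rw [setIntegral_congr_fun measurableSet_Ioi hEq]
  refine (integral_add (jb.add jc) jd).trans ?_
  rw [integral_add' jb jc, integral_const_mul, integral_const_mul, integral_const_mul, vb, vc, vd, sq_sub_sq, sq_sub_sq,
    sq_sub_sq]
  have hbc0 : b + c ≠ 0 := by positivity
  have hcd0 : c + d ≠ 0 := by positivity
  have hbd0 : b + d ≠ 0 := by positivity
  field_simp
  ring

/-- The function whose Mellin transform is the Stieltjes transform of `r1` at `r ^ 2`. -/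
def stieltjesKernel (r t : ℝ) : ℂ :=
  1 / ((1 + (t : ℂ)) * ((1 + (r : ℂ) * (Real.sqrt t : ℂ)) * ((Real.sqrt t : ℂ) + (r : ℂ))))

theorem stieltjesKernel_eq_ofReal (r t : ℝ) : stieltjesKernel r t =
    ((1 / ((1 + t) * ((1 + r * Real.sqrt t) * (Real.sqrt t + r))) : ℝ) : ℂ) := by
  simp [stieltjesKernel]

theorem mellin_stieltjesKernel_regular {r : ℝ} (hr : 0 < r) {s : ℂ} (hs0 : 0 < s.re)
    (hs2 : s.re < 2) :
    MellinConvergent (stieltjesKernel r) s ∧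
      DifferentiableAt ℂ (mellin (stieltjesKernel r)) s := by
  refine mellin_regular_of_bound (C := 1 / r) (a := 2) ?_ ?_ ?_ hs0 hs2
  · refine ContinuousOn.div (by fun_prop) (by fun_prop) fun t ht => ?_
    have : 0 < t := ht
    exact_mod_cast (by positivity : (1 + t) * ((1 + r * Real.sqrt t) * (Real.sqrt t + r)) ≠ 0)
  all_goals
    intro t ht
    have hs : 0 < Real.sqrt t := Real.sqrt_pos.2 ht
    have hQ : r * (1 + t) ≤ (1 + r * Real.sqrt t) * (Real.sqrt t + r) := by
      have h1 : (1 + r * Real.sqrt t) * (Real.sqrt t + r)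
          = r * (1 + Real.sqrt t ^ 2) + (1 + r ^ 2) * Real.sqrt t := by ring
      rw [h1, Real.sq_sqrt ht.le]
      have : 0 < (1 + r ^ 2) * Real.sqrt t := by positivity
      linarith
    have hPQ := mul_le_mul_of_nonneg_left hQ (by positivity : 0 ≤ 1 + t)
    rw [stieltjesKernel_eq_ofReal, Complex.norm_real, Real.norm_of_nonneg (by positivity)]
  · refine one_div_le_one_div_of_le hr (le_trans ?_ hPQ)
    nlinarith [mul_pos hr ht, mul_pos (mul_pos hr ht) ht]
  · rw [Real.rpow_neg ht.le, Real.rpow_two, ← one_div, one_div_mul_one_div]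
    refine one_div_le_one_div_of_le (by positivity) (le_trans ?_ hPQ)
    nlinarith [mul_pos hr ht, mul_pos (mul_pos hr ht) ht]

theorem mellin_stieltjesKernel {r : ℝ} (hr : 0 < r) {s : ℂ} (hs0 : 0 < s.re) (hs1 : s.re < 1) :
    mellin (stieltjesKernel r) (s + 1/2) = (Real.pi / Complex.sin (Real.pi * s)
      - 2 * r * mellin (pairKernel r) (2 * s)) / (1 + (r : ℂ) ^ 2) := by
  have hcomp : mellin (fun t : ℝ => pairKernel r (t ^ (1/2 : ℝ))) s
      = 2 * mellin (pairKernel r) (2 * s) := by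
    have := mellin_comp_rpow (pairKernel r) s (1/2)
    rw [this, show s / ((1/2 : ℝ) : ℂ) = 2 * s by push_cast; ring,
      abs_of_pos (by norm_num : (0 : ℝ) < 1/2), Complex.real_smul]
    norm_num
  have hconv : MellinConvergent (fun t : ℝ => pairKernel r (t ^ (1/2 : ℝ))) s := by
    rw [MellinConvergent.comp_rpow (by norm_num)]
    rw [show s / ((1/2 : ℝ) : ℂ) = 2 * s by push_cast; ring]
    exact (mellin_pairKernel_regular hr (by simpa using hs0) (by simp; linarith)).1
  have hone := mellinConvergent_one_div_add one_pos hs0 hs1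
  have hsub := hasMellin_sub hone (hasMellin_const_smul hconv (r : ℂ)).1
  rw [(hasMellin_const_smul hconv (r : ℂ)).2, mellin_one_div_add one_pos hs0 hs1, hcomp] at hsub
  have hK : mellin (stieltjesKernel r) (s + 1/2) = mellin (fun t : ℝ =>
      (1 / ((t : ℂ) + ((1 : ℝ) : ℂ)) - (r : ℂ) • pairKernel r (t ^ (1/2 : ℝ)))
        / (1 + (r : ℂ) ^ 2)) s := by
    refine setIntegral_congr_fun measurableSet_Ioi fun t ht => ?_
    have ht : 0 < t := ht
    have hs : 0 < Real.sqrt t := Real.sqrt_pos.2 ht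
    have htc : (t : ℂ) ≠ 0 := by exact_mod_cast ht.ne'
    have hpow : (t : ℂ) ^ (s + 1/2 - 1) = (t : ℂ) ^ (s - 1) * (Real.sqrt t : ℂ) := by
      rw [Real.sqrt_eq_rpow, Complex.ofReal_cpow ht.le, ← Complex.cpow_add _ _ htc]
      congr 1
      push_cast
      ring
    have h1 : (1 + (r : ℂ) * (Real.sqrt t : ℂ)) ≠ 0 := by
      exact_mod_cast (by positivity : 1 + r * Real.sqrt t ≠ 0)
    have h2 : ((Real.sqrt t : ℂ) + r) ≠ 0 := by
      exact_mod_cast (by positivity : Real.sqrt t + r ≠ 0)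
    have h3 : (1 + (r : ℂ) ^ 2) ≠ 0 := by exact_mod_cast (by positivity : 1 + r ^ 2 ≠ 0)
    have h4 : (1 + (Real.sqrt t : ℂ) ^ 2) ≠ 0 := by
      exact_mod_cast (by positivity : 1 + Real.sqrt t ^ 2 ≠ 0)
    have hsq : (t : ℂ) = (Real.sqrt t : ℂ) ^ 2 := by
      exact_mod_cast (Real.sq_sqrt ht.le).symm
    simp only [smul_eq_mul]
    rw [hpow, mul_assoc]
    congr 1
    rw [← Real.sqrt_eq_rpow, stieltjesKernel, pairKernel, hsq, Complex.ofReal_one,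
      add_comm _ (1 : ℂ)]
    generalize (Real.sqrt t : ℂ) = w at *
    have h1' : 1 + w * (r : ℂ) ≠ 0 := by rwa [mul_comm]
    field_simp
    ring
  rw [hK, mellin_div_const, hsub.2]
  simp [mul_assoc, mul_left_comm]

theorem mellin_pairKernel_eq_stieltjes {r : ℝ} (hr : 0 < r) (hr1 : r ≠ 1) {α : ℂ}
    (hα1 : -1 < α.re) (hα2 : α.re < 1/2) :
    (r : ℂ) / Real.pi * mellin (pairKernel (r ^ 2)) (α + 3/2)
      = 1 / (1 + (r : ℂ) ^ 2)
        + Complex.sin (Real.pi * α) / Real.pi * mellin (stieltjesKernel r) (α + 3/2) := by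
  refine eqOn_strip_of_eqOn_left (a := -1) (b := -(1/2)) (c := 1/2)
    (f := fun α => (r : ℂ) / Real.pi * mellin (pairKernel (r ^ 2)) (α + 3/2))
    (g := fun α => 1 / (1 + (r : ℂ) ^ 2)
        + Complex.sin (Real.pi * α) / Real.pi * mellin (stieltjesKernel r) (α + 3/2))
    (by norm_num) (by norm_num) ?_ ?_ ?_ hα1 hα2
  · intro z hz
    have h := (mellin_pairKernel_regular (y := r ^ 2) (by positivity) (s := z + 3/2)
      (by norm_num; linarith [hz.1]) (by norm_num; linarith [hz.2])).2
    exact ((h.comp z (by fun_prop : DifferentiableAt ℂ (fun w : ℂ => w + 3/2) z)).const_mul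
      _).differentiableWithinAt
  · intro z hz
    have h := (mellin_stieltjesKernel_regular hr (s := z + 3/2)
      (by norm_num; linarith [hz.1]) (by norm_num; linarith [hz.2])).2
    exact (((by fun_prop : DifferentiableAt ℂ (fun w : ℂ => Complex.sin (Real.pi * w) / Real.pi)
      z).mul (h.comp z (by fun_prop : DifferentiableAt ℂ (fun w : ℂ => w + 3/2) z))).const_add
      _).differentiableWithinAt
  · intro z hz1 hz2
    obtain ⟨s, rfl⟩ : ∃ s, z = s - 1 := ⟨z + 1, by ring⟩
    simp only [Complex.sub_re, Complex.one_re] at hz1 hz2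
    have hrc : (r : ℂ) ≠ 0 := by exact_mod_cast hr.ne'
    have hpi : (Real.pi : ℂ) ≠ 0 := by exact_mod_cast Real.pi_ne_zero
    have hr2 : r ^ 2 ≠ 1 := by
      rwa [Ne, pow_eq_one_iff_of_nonneg hr.le two_ne_zero]
    have hadd : (1 + (r : ℂ) ^ 2) ≠ 0 := by exact_mod_cast (by positivity : 1 + r ^ 2 ≠ 0)
    have hsub : (1 - (r : ℂ) ^ 2) ≠ 0 := by
      exact_mod_cast sub_ne_zero.2 hr2.symm
    have hA := sin_mul_mellin_pairKernel hr hr1 (s := 2 * s) (by simp; linarith)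
      (by simp; linarith)
    have hB := sin_mul_mellin_pairKernel (y := r ^ 2) (by positivity) hr2 (s := s + 1/2)
      (by norm_num; linarith) (by norm_num; linarith)
    have hsin := sin_pi_mul_ne_zero_of_re_pos (s := s) (by linarith) (by linarith)
    have hcos := sin_pi_mul_ne_zero_of_re_pos (s := s + 1/2) (by norm_num; linarith)
      (by norm_num; linarith)
    have hcos_eq : Complex.sin (Real.pi * (s + 1/2)) = Complex.cos (Real.pi * s) := by
      rw [mul_add, ← mul_div_assoc, mul_one, Complex.sin_add_pi_div_two]
    have hpow (w : ℂ) : ((r ^ 2 : ℝ) : ℂ) ^ w = (r : ℂ) ^ (2 * w) := by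
      rw [Complex.ofReal_pow, two_mul, Complex.cpow_add _ _ hrc, sq,
        Complex.mul_cpow_ofReal_nonneg hr.le hr.le]
    rw [hcos_eq] at hcos hB
    rw [hpow, hpow, show 2 * (s + 1/2 - 1) = 2 * s - 1 by ring,
      show 2 * (1 - (s + 1/2)) = 1 - 2 * s by ring] at hB
    rw [show (Real.pi : ℂ) * (2 * s) = 2 * (Real.pi * s) by ring, Complex.sin_two_mul] at hA
    have hkey : mellin (pairKernel (r ^ 2)) (s + 1/2)
        = 2 * Complex.sin (Real.pi * s) * mellin (pairKernel r) (2 * s) / (1 + (r : ℂ) ^ 2) := by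
      refine mul_left_cancel₀ hcos ?_
      have hfac : (1 - ((r ^ 2 : ℝ) : ℂ) ^ 2) = (1 - (r : ℂ) ^ 2) * (1 + (r : ℂ) ^ 2) := by
        push_cast
        ring
      rw [hB, hfac, ← div_div, ← hA]
      ring
    have hneg : Complex.sin (Real.pi * (s - 1)) = -Complex.sin (Real.pi * s) := by
      rw [mul_sub, mul_one, Complex.sin_sub_pi]
    rw [show s - 1 + 3/2 = s + 1/2 by ring, hkey, hneg,
      mellin_stieltjesKernel hr (by linarith) (by linarith)]
    field_simp
    ring

theorem integral_pairKernel_mul_sqrt {r t : ℝ} (hr : 0 < r) (ht : 0 < t) (ht1 : t ≠ 1)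
    (htr : t ≠ r ^ 2) (htr' : t ≠ (r ^ 2)⁻¹) :
    IntegrableOn (fun y : ℝ => Real.sqrt y / ((1 + y * t) * (t + y) * (r ^ 2 + y))) (Ioi 0) ∧
      ∫ y in Ioi (0 : ℝ), Real.sqrt y / ((1 + y * t) * (t + y) * (r ^ 2 + y))
        = Real.pi / ((1 + t) * ((1 + r * Real.sqrt t) * (Real.sqrt t + r))) := by
  obtain ⟨w, hw, rfl⟩ : ∃ w : ℝ, 0 < w ∧ t = w ^ 2 :=
    ⟨Real.sqrt t, Real.sqrt_pos.2 ht, (Real.sq_sqrt ht.le).symm⟩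
  have hwi : 0 < w⁻¹ := inv_pos.2 hw
  have h1 : w ≠ w⁻¹ := fun h => ht1 (by rw [sq]; nth_rw 2 [h]; exact mul_inv_cancel₀ hw.ne')
  have h2 : w⁻¹ ≠ r := fun h => htr' (by rw [← h]; simp)
  have h3 : w ≠ r := fun h => htr (by rw [h])
  obtain ⟨hi, hv⟩ := integral_sqrt_div_mul_mul hw hwi hr h1 h2 h3
  have hEq : EqOn (fun y : ℝ => Real.sqrt y / ((1 + y * w ^ 2) * (w ^ 2 + y) * (r ^ 2 + y)))
      (fun y => (w ^ 2)⁻¹ * (Real.sqrt y / ((y + w ^ 2) * (y + w⁻¹ ^ 2) * (y + r ^ 2))))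
      (Ioi 0) := by
    intro y hy
    have hy : 0 < y := hy
    simp only
    field_simp
    ring
  refine ⟨(integrableOn_congr_fun hEq measurableSet_Ioi).2 (hi.const_mul _), ?_⟩
  rw [setIntegral_congr_fun measurableSet_Ioi hEq, integral_const_mul, hv, Real.sqrt_sq hw.le]
  field_simp
  ring

theorem stieltjes_r1_eq_mellin {α : ℂ} (hα1 : -(1/2) ≤ α.re) (hα2 : α.re < 1/2) {r : ℝ}
    (hr : 0 < r) :
    IntegrableOn (fun y : ℝ => r1 α y / (((r ^ 2 : ℝ) : ℂ) + (y : ℂ))) (Ioi 0) ∧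
      ∫ y in Ioi (0 : ℝ), r1 α y / (((r ^ 2 : ℝ) : ℂ) + (y : ℂ))
        = mellin (stieltjesKernel r) (α + 3/2) := by
  have hpi : (Real.pi : ℂ) ≠ 0 := by exact_mod_cast Real.pi_ne_zero
  set μ : Measure ℝ := volume.restrict (Ioi 0) with hμ
  let k : ℝ → ℝ → ℝ := fun y t => Real.sqrt y / ((1 + y * t) * (t + y) * (r ^ 2 + y))
  let F : ℝ → ℝ → ℂ := fun y t => (t : ℂ) ^ (α + 3/2 - 1) * (k y t : ℂ)
  have hregular := (mellin_stieltjesKernel_regular hr (s := α + 3/2)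
    (by norm_num; linarith) (by norm_num; linarith)).1
  have hpos : ∀ᵐ t ∂μ, 0 < t := ae_restrict_mem measurableSet_Ioi
  have hne (c : ℝ) : ∀ᵐ t ∂μ, t ≠ c := ae_restrict_of_ae (Measure.ae_ne volume c)
  have hinner : ∀ᵐ t ∂μ, Integrable (fun y => k y t) μ ∧ ∫ y, k y t ∂μ
      = Real.pi / ((1 + t) * ((1 + r * Real.sqrt t) * (Real.sqrt t + r))) := by
    filter_upwards [hpos, hne 1, hne (r ^ 2), hne (r ^ 2)⁻¹] with t h0 h1 h2 h3
    exact integral_pairKernel_mul_sqrt hr h0 h1 h2 h3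
  have hinnerF : ∀ᵐ t ∂μ, ∫ y, F y t ∂μ
      = Real.pi * ((t : ℂ) ^ (α + 3/2 - 1) • stieltjesKernel r t) := by
    filter_upwards [hinner] with t ht
    simp only [F]
    rw [integral_const_mul, integral_complex_ofReal, ht.2, stieltjesKernel_eq_ofReal, smul_eq_mul]
    push_cast
    ring
  have hmeas : Measurable (Function.uncurry F) := by
    simp only [F, k, Function.uncurry_def]
    fun_prop
  have hF : Integrable (Function.uncurry F) (μ.prod μ) := by
    rw [integrable_prod_iff' hmeas.aestronglyMeasurable]
    constructor
    · filter_upwards [hinner] with t ht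
      exact (ht.1.ofReal (𝕜 := ℂ)).const_mul ((t : ℂ) ^ (α + 3/2 - 1))
    · refine (hregular.norm.const_mul Real.pi).congr ?_
      filter_upwards [hinner, hpos] with t ht h0
      have hnorm : ∀ᵐ y ∂μ, ‖Function.uncurry F (y, t)‖ = ‖(t : ℂ) ^ (α + 3/2 - 1)‖ * k y t := by
        filter_upwards [hpos] with y hy
        have : 0 ≤ k y t := by positivity
        simp only [Function.uncurry_apply_pair, F]
        rw [norm_mul, Complex.norm_real, Real.norm_of_nonneg this]
      rw [integral_congr_ae hnorm, integral_const_mul, ht.2, norm_smul, stieltjesKernel_eq_ofReal,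
        Complex.norm_real, Real.norm_of_nonneg (by positivity)]
      ring
  have houter : ∀ᵐ y ∂μ, ∫ t, F y t ∂μ = Real.pi * (r1 α y / (((r ^ 2 : ℝ) : ℂ) + (y : ℂ))) := by
    filter_upwards [hpos, hne 1] with y hy hy1
    rw [r1_eq_mellin_pairKernel hα1 hα2 hy hy1, mellin,
      show (Real.pi : ℂ) * ((Real.sqrt y : ℂ) / Real.pi *
        (∫ t in Ioi (0 : ℝ), (t : ℂ) ^ (α + 3/2 - 1) • pairKernel y t)
          / (((r ^ 2 : ℝ) : ℂ) + (y : ℂ)))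
        = ((Real.sqrt y : ℂ) / (((r ^ 2 : ℝ) : ℂ) + (y : ℂ))) *
          ∫ t in Ioi (0 : ℝ), (t : ℂ) ^ (α + 3/2 - 1) • pairKernel y t by field_simp,
      ← integral_const_mul]
    refine integral_congr_ae (Filter.Eventually.of_forall fun t => ?_)
    simp only [F, k, pairKernel, smul_eq_mul]
    push_cast
    simp only [div_eq_mul_inv, mul_inv, one_mul]
    ring
  have hint : Integrable (fun y => Real.pi * (r1 α y / (((r ^ 2 : ℝ) : ℂ) + (y : ℂ)))) μ :=
    hF.integral_prod_left.congr houter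
  refine ⟨(hint.const_mul (Real.pi : ℂ)⁻¹).congr
    (Filter.Eventually.of_forall fun y => inv_mul_cancel_left₀ hpi _), ?_⟩
  have hswap := integral_integral_swap hF
  rw [integral_congr_ae houter, integral_congr_ae hinnerF, integral_const_mul,
    integral_const_mul] at hswap
  exact mul_left_cancel₀ hpi hswap

/-- `r₁(·;α)` satisfies the Stieltjes equation with `g(x) = 1/(1+x)`,
for `-1/2 ≤ Re α < 1/2`, `λ = sin(πα)/π`. -/
theorem stmt3 (α : ℂ) (hα1 : -(1/2) ≤ α.re) (hα2 : α.re < 1/2)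
    (lam : ℂ) (hlam : lam = Complex.sin ((Real.pi : ℂ) * α) / (Real.pi : ℂ)) :
    ∀ x : ℝ, 0 < x → x ≠ 1 →
      IntegrableOn (fun y : ℝ => r1 α y / ((x : ℂ) + (y : ℂ))) (Ioi 0) ∧
      r1 α x = 1 / (1 + (x : ℂ)) + lam * ∫ y in Ioi (0 : ℝ), r1 α y / ((x : ℂ) + (y : ℂ)) := by
  intro x hx hx1
  obtain ⟨r, hr, rfl⟩ : ∃ r : ℝ, 0 < r ∧ x = r ^ 2 :=
    ⟨Real.sqrt x, Real.sqrt_pos.2 hx, (Real.sq_sqrt hx.le).symm⟩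
  have hr1 : r ≠ 1 := fun h => hx1 (by rw [h, one_pow])
  obtain ⟨hint, hval⟩ := stieltjes_r1_eq_mellin hα1 hα2 hr
  refine ⟨hint, ?_⟩
  rw [hval, r1_eq_mellin_pairKernel hα1 hα2 hx hx1, Real.sqrt_sq hr.le, hlam,
    mellin_pairKernel_eq_stieltjes hr hr1 (by linarith) hα2, Complex.ofReal_pow]

end
end

section
/- Let α ∈ ℂ with 0 < Re α ≤ 1/2 and set λ = sin(πα)/π. Then for i = 2 and i = 3 and for every x > 0 with x ≠ 1, the integral ∫₀^∞ rᵢ(y;α)/(x+y) dy converges and rᵢ(x;α) = 1/(1+x) + λ ∫₀^∞ rᵢ(y;α)/(x+y) dy; that is, r₂(·;α) and r₃(·;α) satisfy the Stieltjes equation with given function g(x) = 1/(1+x). -/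
open MeasureTheory Set Asymptotics

noncomputable section

theorem mellin_inv_one_add {s : ℂ} (hs0 : 0 < s.re) (hs1 : s.re < 1) :
    mellin (fun t : ℝ => (1 + (t : ℂ))⁻¹) s = Real.pi / Complex.sin (Real.pi * s) := by
  have himg : (fun u : ℝ => u / (1 - u)) '' Ioo 0 1 = Ioi 0 := by
    ext y
    simp only [mem_image, mem_Ioo, mem_Ioi]
    constructor
    · rintro ⟨u, ⟨h0, h1⟩, rfl⟩
      exact div_pos h0 (by linarith)
    · intro hy
      refine ⟨y / (1 + y), ⟨by positivity, by rw [div_lt_one (by positivity)]; linarith⟩, ?_⟩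
      field_simp
      ring
  have hder : ∀ u ∈ Ioo (0 : ℝ) 1,
      HasDerivWithinAt (fun u : ℝ => u / (1 - u)) (1 / (1 - u) ^ 2) (Ioo 0 1) u := by
    intro u hu
    have hne : 1 - u ≠ 0 := by linarith [hu.2]
    have := ((hasDerivAt_id u).div ((hasDerivAt_id u).const_sub 1) hne).hasDerivWithinAt
      (s := Ioo 0 1)
    convert! this using 1
    simp
  have hinj : InjOn (fun u : ℝ => u / (1 - u)) (Ioo 0 1) := by
    intro u hu v hv h
    have h1 : 1 - u ≠ 0 := by linarith [hu.2]
    have h2 : 1 - v ≠ 0 := by linarith [hv.2]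
    simp only at h
    rw [div_eq_div_iff h1 h2] at h
    linarith
  rw [mellin, ← himg, integral_image_eq_integral_abs_deriv_smul measurableSet_Ioo hder hinj]
  have hbeta : Complex.betaIntegral s (1 - s) = Real.pi / Complex.sin (Real.pi * s) := by
    rw [← Complex.Gamma_mul_Gamma_one_sub,
      Complex.Gamma_mul_Gamma_eq_betaIntegral hs0 (by simpa using hs1)]
    simp
  rw [← hbeta, Complex.betaIntegral, intervalIntegral.integral_of_le zero_le_one,
    integral_Ioc_eq_integral_Ioo]
  refine setIntegral_congr_fun measurableSet_Ioo fun u hu => ?_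
  have h1 : (0 : ℝ) < 1 - u := by linarith [hu.2]
  have h1' : (1 - (u : ℂ)) ≠ 0 := by exact_mod_cast h1.ne'
  have e1 : (1 + ((u / (1 - u) : ℝ) : ℂ))⁻¹ = 1 - u := by
    push_cast
    field_simp
    ring
  have e2 : ((u / (1 - u) : ℝ) : ℂ) ^ (s - 1) = (u : ℂ) ^ (s - 1) * (1 - (u : ℂ)) ^ (1 - s) := by
    rw [div_eq_mul_inv, Complex.ofReal_mul, Complex.mul_cpow_ofReal_nonneg hu.1.le (by positivity)]
    congr 1
    rw [Complex.ofReal_inv, ← neg_sub s 1, Complex.cpow_neg, Complex.inv_cpow]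
    · push_cast; rfl
    · rw [Complex.arg_ofReal_of_nonneg h1.le]; exact Real.pi_ne_zero.symm
  have e3 : (1 - (u : ℂ)) ^ (1 - s - 1) = (1 - (u : ℂ)) ^ (1 - s) / (1 - u) := by
    rw [Complex.cpow_sub _ _ h1', Complex.cpow_one]
  rw [abs_of_pos (by positivity), e1, e2, e3]
  simp only [Complex.real_smul, smul_eq_mul]
  push_cast
  field_simp

theorem mellin_inv_const_add {x : ℝ} (hx : 0 < x) {s : ℂ} (hs0 : 0 < s.re) (hs1 : s.re < 1) :
    mellin (fun t : ℝ => ((x : ℂ) + t)⁻¹) s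
      = Real.pi / Complex.sin (Real.pi * s) * (x : ℂ) ^ (s - 1) := by
  have hx' : (x : ℂ) ≠ 0 := by exact_mod_cast hx.ne'
  have h := mellin_comp_mul_left (fun t : ℝ => (1 + (t : ℂ))⁻¹) s (inv_pos.mpr hx)
  have e : (fun t : ℝ => ((x : ℂ) + t)⁻¹) = fun t : ℝ => (x : ℂ)⁻¹ • (1 + ((x⁻¹ * t : ℝ) : ℂ))⁻¹ := by
    funext t
    rw [smul_eq_mul, ← mul_inv]
    congr 1
    push_cast
    field_simp
  rw [e, mellin_const_smul, h, mellin_inv_one_add hs0 hs1, Complex.ofReal_inv, Complex.inv_cpow,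
    Complex.cpow_neg, inv_inv, Complex.cpow_sub _ _ hx', Complex.cpow_one]
  · simp only [smul_eq_mul]
    ring
  · rw [Complex.arg_ofReal_of_nonneg hx.le]; exact Real.pi_ne_zero.symm

theorem mellin_inv_const_add_hasDerivAt {x : ℝ} (hx : 0 < x) {s : ℂ}
    (hs0 : 0 < s.re) (hs1 : s.re < 1) :
    MellinConvergent (fun t : ℝ => ((x : ℂ) + t)⁻¹) s ∧
    MellinConvergent (fun t : ℝ => Real.log t • ((x : ℂ) + t)⁻¹) s ∧
      HasDerivAt (mellin fun t : ℝ => ((x : ℂ) + t)⁻¹)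
        (mellin (fun t : ℝ => Real.log t • ((x : ℂ) + t)⁻¹) s) s := by
  have hloc : LocallyIntegrableOn (fun t : ℝ => ((x : ℂ) + t)⁻¹) (Ioi 0) := by
    refine ContinuousOn.locallyIntegrableOn ?_ measurableSet_Ioi
    refine ContinuousOn.inv₀ (by fun_prop) fun t ht => ?_
    have : x + t ≠ 0 := by have : 0 < t := ht; positivity
    exact_mod_cast this
  have hnorm : ∀ t : ℝ, 0 < t → ‖((x : ℂ) + t)⁻¹‖ = (x + t)⁻¹ := by
    intro t ht
    rw [← Complex.ofReal_add, norm_inv, Complex.norm_real, Real.norm_of_nonneg (by positivity)]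
  have htop : (fun t : ℝ => ((x : ℂ) + t)⁻¹) =O[Filter.atTop] (· ^ (-1 : ℝ)) := by
    refine IsBigO.of_bound 1 ?_
    filter_upwards [Filter.eventually_gt_atTop 0] with t ht
    rw [hnorm t ht, Real.rpow_neg_one, Real.norm_of_nonneg (by positivity), one_mul]
    gcongr
    linarith
  have hbot : (fun t : ℝ => ((x : ℂ) + t)⁻¹) =O[nhdsWithin 0 (Ioi 0)] (· ^ (-0 : ℝ)) := by
    refine IsBigO.of_bound x⁻¹ ?_
    filter_upwards [self_mem_nhdsWithin] with t ht
    have ht : 0 < t := ht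
    rw [hnorm t ht]
    simp only [neg_zero, Real.rpow_zero, norm_one, mul_one]
    gcongr
    linarith
  exact ⟨mellinConvergent_of_isBigO_rpow hloc htop hs1 hbot hs0,
    mellin_hasDerivAt_of_isBigO_rpow hloc htop hs1 hbot hs0⟩

theorem exists_mul_one_add_le_norm_add {z : ℂ} (hz : z ∈ Complex.slitPlane) :
    ∃ r > 0, ∃ c > 0, ∀ w ∈ Metric.ball z r, ∀ y : ℝ, 0 < y → c * (1 + y) ≤ ‖w + y‖ := by
  obtain ⟨r, hr, hball⟩ := Metric.nhds_basis_closedBall.mem_iff.mp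
    (Complex.isOpen_slitPlane.mem_nhds hz)
  have hK : IsCompact (Icc (0 : ℝ) 1 ×ˢ Metric.closedBall z r) :=
    isCompact_Icc.prod (isCompact_closedBall z r)
  have hcont : ContinuousOn (fun p : ℝ × ℂ => ‖(p.1 : ℂ) + (1 - p.1) * p.2‖)
      (Icc (0 : ℝ) 1 ×ˢ Metric.closedBall z r) := by fun_prop
  have hpos : ∀ p ∈ Icc (0 : ℝ) 1 ×ˢ Metric.closedBall z r,
      0 < ‖(p.1 : ℂ) + (1 - p.1) * p.2‖ := by
    rintro ⟨t, w⟩ ⟨ht, hw⟩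
    have := Complex.starConvex_one_slitPlane (hball hw) ht.1 (sub_nonneg.mpr ht.2) (by ring)
    have h0 := Complex.slitPlane_ne_zero this
    simpa using h0
  obtain ⟨c, hc, hle⟩ := hK.exists_forall_le' hcont hpos
  refine ⟨r, hr, c, hc, fun w hw y hy => ?_⟩
  have h := hle (y / (1 + y), w) ⟨⟨by positivity, by rw [div_le_one (by positivity)]; linarith⟩,
    Metric.ball_subset_closedBall hw⟩
  have hy1 : (1 + (y : ℂ)) ≠ 0 := by exact_mod_cast (by positivity : 1 + y ≠ 0)
  have e : w + y = ((1 + y : ℝ) : ℂ) *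
      (((y / (1 + y) : ℝ) : ℂ) + (1 - ((y / (1 + y) : ℝ) : ℂ)) * w) := by
    push_cast
    field_simp
    ring
  rw [e, norm_mul, Complex.norm_real, Real.norm_of_nonneg (by positivity), mul_comm c]
  gcongr

theorem aemeasurable_of_integrableOn_div_one_add {h : ℝ → ℂ}
    (hint : IntegrableOn (fun y : ℝ => h y / (1 + (y : ℂ))) (Ioi 0)) :
    AEMeasurable h (volume.restrict (Ioi 0)) := by
  refine (hint.aemeasurable.mul (g := fun y : ℝ => 1 + (y : ℂ)) (by fun_prop)).congr ?_
  filter_upwards [ae_restrict_mem measurableSet_Ioi] with y hy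
  have hy : 0 < y := hy
  exact div_mul_cancel₀ _ (by exact_mod_cast (by positivity : 1 + y ≠ 0))

theorem norm_one_add_ofReal {y : ℝ} (hy : 0 < y) : ‖(1 + (y : ℂ))‖ = 1 + y := by
  rw [← Complex.ofReal_one, ← Complex.ofReal_add, Complex.norm_real,
    Real.norm_of_nonneg (by positivity)]

theorem norm_ofReal_sub_one (y : ℝ) : ‖((y : ℂ) - 1)‖ = |y - 1| := by
  rw [← Complex.ofReal_one, ← Complex.ofReal_sub, Complex.norm_real, Real.norm_eq_abs]

theorem differentiableOn_stieltjes {h : ℝ → ℂ}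
    (hint : IntegrableOn (fun y : ℝ => h y / (1 + (y : ℂ))) (Ioi 0)) :
    DifferentiableOn ℂ (fun z : ℂ => ∫ y in Ioi (0 : ℝ), h y / (z + (y : ℂ)))
      Complex.slitPlane := by
  intro z hz
  obtain ⟨r, hr, c, hc, hle⟩ := exists_mul_one_add_le_norm_add hz
  have hmeas := aemeasurable_of_integrableOn_div_one_add hint
  have hFmeas : ∀ w : ℂ, AEStronglyMeasurable (fun y : ℝ => h y / (w + (y : ℂ)))
      (volume.restrict (Ioi 0)) := fun w =>
    (hmeas.div (by fun_prop)).aestronglyMeasurable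
  have hne : ∀ w ∈ Metric.ball z r, ∀ y : ℝ, 0 < y → w + (y : ℂ) ≠ 0 := fun w hw y hy =>
    norm_pos_iff.mp (lt_of_lt_of_le (by positivity) (hle w hw y hy))
  have hbd : ∀ w ∈ Metric.ball z r, ∀ y : ℝ, 0 < y →
      ‖h y / (w + (y : ℂ))‖ ≤ c⁻¹ * ‖h y / (1 + (y : ℂ))‖ := by
    intro w hw y hy
    rw [norm_div, norm_div, norm_one_add_ofReal hy]
    calc ‖h y‖ / ‖w + y‖ ≤ ‖h y‖ / (c * (1 + y)) := by gcongr; exact hle w hw y hy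
      _ = _ := by field_simp
  have key := hasDerivAt_integral_of_dominated_loc_of_deriv_le (μ := volume.restrict (Ioi 0))
    (F := fun (w : ℂ) (y : ℝ) => h y / (w + (y : ℂ)))
    (F' := fun (w : ℂ) (y : ℝ) => -(h y) / (w + (y : ℂ)) ^ 2)
    (bound := fun y => c⁻¹ * c⁻¹ * ‖h y / (1 + (y : ℂ))‖)
    (Metric.ball_mem_nhds z hr) (Filter.Eventually.of_forall hFmeas)
    ?_ (hmeas.neg.div (by fun_prop)).aestronglyMeasurable ?_ (hint.norm.const_mul _) ?_
  · exact key.2.differentiableAt.differentiableWithinAt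
  · refine (hint.norm.const_mul c⁻¹).mono' (hFmeas z) ?_
    filter_upwards [ae_restrict_mem measurableSet_Ioi] with y hy
    exact hbd z (Metric.mem_ball_self hr) y hy
  · filter_upwards [ae_restrict_mem measurableSet_Ioi] with y hy w hw
    have hy : 0 < y := hy
    have h1 := hbd w hw y hy
    have h2 : ‖(w + (y : ℂ))⁻¹‖ ≤ c⁻¹ := by
      rw [norm_inv]
      gcongr
      refine le_trans ?_ (hle w hw y hy)
      nlinarith
    have e : -(h y) / (w + (y : ℂ)) ^ 2 = -((w + (y : ℂ))⁻¹ * (h y / (w + y))) := by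
      rw [inv_mul_eq_div, div_div, ← sq, neg_div]
    rw [e, norm_neg, norm_mul, mul_assoc]
    gcongr
  · filter_upwards [ae_restrict_mem measurableSet_Ioi] with y hy w hw
    have := (hasDerivAt_const w (h y)).div ((hasDerivAt_id w).add_const (y : ℂ)) (hne w hw y hy)
    convert! this using 1
    simp

theorem stieltjes_eq_of_eq_on_pos {h : ℝ → ℂ} {G : ℂ → ℂ}
    (hint : IntegrableOn (fun y : ℝ => h y / (1 + (y : ℂ))) (Ioi 0))
    (hG : DifferentiableOn ℂ G Complex.slitPlane)
    (heq : ∀ x : ℝ, 0 < x → ∫ y in Ioi (0 : ℝ), h y / ((x : ℂ) + (y : ℂ)) = G x)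
    {z : ℂ} (hz : z ∈ Complex.slitPlane) :
    ∫ y in Ioi (0 : ℝ), h y / (z + (y : ℂ)) = G z := by
  refine ((differentiableOn_stieltjes hint).analyticOnNhd
    Complex.isOpen_slitPlane).eqOn_of_preconnected_of_frequently_eq
    (hG.analyticOnNhd Complex.isOpen_slitPlane)
    (Complex.starConvex_one_slitPlane.isPathConnected
      Complex.one_mem_slitPlane).isConnected.isPreconnected Complex.one_mem_slitPlane ?_ hz
  have ht : Filter.Tendsto (fun x : ℝ => (x : ℂ)) (nhdsWithin 1 {1}ᶜ) (nhdsWithin 1 {1}ᶜ) := by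
    refine Complex.continuous_ofReal.continuousWithinAt.tendsto_nhdsWithin ?_
    intro x hx
    simpa using hx
  refine ht.frequently (Filter.Eventually.frequently ?_)
  filter_upwards [nhdsWithin_le_nhds (Ioi_mem_nhds zero_lt_one)] with x hx
  exact heq x hx

theorem integrableOn_div_sub_one {h : ℝ → ℂ} {d : ℂ}
    (hint : IntegrableOn (fun y : ℝ => h y / (1 + (y : ℂ))) (Ioi 0))
    (hd : HasDerivAt h d 1) (h1 : h 1 = 0) :
    IntegrableOn (fun y : ℝ => h y / ((y : ℂ) - 1)) (Ioi 0) := by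
  have hmeas := aemeasurable_of_integrableOn_div_one_add hint
  obtain ⟨M, hM⟩ := hd.isBigO_sub.bound
  obtain ⟨r, hr, hrM⟩ := Metric.eventually_nhds_iff_ball.mp hM
  have hind : IntegrableOn ((Metric.ball (1 : ℝ) r).indicator fun _ => |M|) (Ioi 0) := by
    refine Integrable.integrableOn ?_
    rw [integrable_indicator_iff measurableSet_ball]
    exact integrableOn_const measure_ball_lt_top.ne
  refine (hind.add (hint.norm.const_mul (1 + 2 / r))).mono' (hmeas.div (by fun_prop)).aestronglyMeasurable ?_
  filter_upwards [ae_restrict_mem measurableSet_Ioi] with y hy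
  have hy : 0 < y := hy
  simp only [Pi.add_apply]
  rw [norm_div, norm_div, norm_one_add_ofReal hy, norm_ofReal_sub_one]
  by_cases hy1 : y ∈ Metric.ball (1 : ℝ) r
  · rw [indicator_of_mem hy1]
    have hle := hrM y hy1
    rw [h1, sub_zero, Real.norm_eq_abs] at hle
    have : ‖h y‖ / |y - 1| ≤ |M| :=
      div_le_of_le_mul₀ (abs_nonneg _) (abs_nonneg _) (hle.trans (by gcongr; exact le_abs_self M))
    have : 0 ≤ (1 + 2 / r) * (‖h y‖ / (1 + y)) := by positivity
    linarith
  · rw [indicator_of_notMem hy1, zero_add]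
    rw [Metric.mem_ball, Real.dist_eq, not_lt] at hy1
    have hpos : 0 < |y - 1| := hr.trans_le hy1
    have hle : 1 + y ≤ (1 + 2 / r) * |y - 1| := by
      have : 2 ≤ 2 / r * |y - 1| := by
        rw [div_mul_eq_mul_div, le_div_iff₀ hr]
        linarith
      linarith [le_abs_self (y - 1)]
    rw [← mul_div_assoc, div_le_div_iff₀ hpos (by positivity)]
    nlinarith [norm_nonneg (h y)]

theorem integral_div_sub_one_eq {h : ℝ → ℂ} {G : ℂ → ℂ} {d L : ℂ}
    (hint : IntegrableOn (fun y : ℝ => h y / (1 + (y : ℂ))) (Ioi 0))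
    (hd : HasDerivAt h d 1) (h1 : h 1 = 0)
    (hG : DifferentiableOn ℂ G Complex.slitPlane)
    (heq : ∀ x : ℝ, 0 < x → ∫ y in Ioi (0 : ℝ), h y / ((x : ℂ) + (y : ℂ)) = G x)
    (hL : Filter.Tendsto G (nhdsWithin (-1) {z : ℂ | 0 ≤ z.im}) (nhds L)) :
    ∫ y in Ioi (0 : ℝ), h y / ((y : ℂ) - 1) = L := by
  have hI := integrableOn_div_sub_one hint hd h1
  have hmeas := aemeasurable_of_integrableOn_div_one_add hint
  have hcont : Continuous fun ε : ℝ => (-1 + ε * Complex.I : ℂ) := by fun_prop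
  have hpath : Filter.Tendsto (fun ε : ℝ => (-1 + ε * Complex.I : ℂ)) (nhdsWithin 0 (Ioi 0))
      (nhdsWithin (-1) {z : ℂ | 0 ≤ z.im}) := by
    have := hcont.continuousWithinAt.tendsto_nhdsWithin (s := Ioi (0 : ℝ)) (x := 0)
      (t := {z : ℂ | 0 ≤ z.im}) (fun ε hε => by simpa using (le_of_lt hε))
    simpa using this
  refine tendsto_nhds_unique (f := fun ε : ℝ => G (-1 + ε * Complex.I)) ?_ (hL.comp hpath)
  have hDCT : Filter.Tendsto (fun ε : ℝ => ∫ y in Ioi (0 : ℝ), h y / (-1 + ε * Complex.I + (y : ℂ)))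
      (nhdsWithin 0 (Ioi 0)) (nhds (∫ y in Ioi (0 : ℝ), h y / ((y : ℂ) - 1))) := by
    refine tendsto_integral_filter_of_dominated_convergence
      (fun y => ‖h y / ((y : ℂ) - 1)‖) ?_ ?_ hI.norm ?_
    · exact Filter.Eventually.of_forall fun ε => (hmeas.div (by fun_prop)).aestronglyMeasurable
    · refine Filter.Eventually.of_forall fun ε => ?_
      filter_upwards [ae_restrict_mem measurableSet_Ioi] with y hy
      rcases eq_or_ne y 1 with rfl | hy1
      · simp [h1]
      rw [norm_div, norm_div]
      have hpos : 0 < ‖((y : ℂ) - 1)‖ := norm_pos_iff.mpr (sub_ne_zero.mpr (by exact_mod_cast hy1))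
      gcongr
      rw [norm_ofReal_sub_one]
      refine le_trans (le_of_eq ?_) (Complex.abs_re_le_norm _)
      congr 1
      simp
      ring
    · filter_upwards [ae_restrict_mem measurableSet_Ioi] with y hy
      rcases eq_or_ne y 1 with rfl | hy1
      · simp [h1]
      have hne : (y : ℂ) - 1 ≠ 0 := sub_ne_zero.mpr (by exact_mod_cast hy1)
      have h2 : Filter.Tendsto (fun ε : ℝ => (-1 + ε * Complex.I + (y : ℂ) : ℂ))
          (nhdsWithin 0 (Ioi 0)) (nhds ((y : ℂ) - 1)) := by
        have := ((hcont.add continuous_const).tendsto' (0 : ℝ) ((y : ℂ) - 1)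
          (by simp; ring)).mono_left (nhdsWithin_le_nhds (s := Ioi 0))
        exact this
      exact tendsto_const_nhds.div h2 hne
  refine hDCT.congr' ?_
  filter_upwards [self_mem_nhdsWithin] with ε hε
  refine stieltjes_eq_of_eq_on_pos hint hG heq ?_
  rw [Complex.mem_slitPlane_iff]
  right
  simpa using ne_of_gt hε

theorem integral_partial_fractions {h F : ℝ → ℂ} {A B C lam x : ℂ}
    (hJ : IntegrableOn (fun y : ℝ => h y / ((y : ℂ) - 1)) (Ioi 0))
    (hone : IntegrableOn (fun y : ℝ => h y / (1 + (y : ℂ))) (Ioi 0))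
    (hx : IntegrableOn (fun y : ℝ => h y / (x + (y : ℂ))) (Ioi 0))
    (h1 : lam * ∫ y in Ioi (0 : ℝ), h y / (1 + (y : ℂ)) = 0)
    (hF : ∀ y : ℝ, 0 < y →
      F y = A * (h y / ((y : ℂ) - 1)) + B * (h y / (1 + (y : ℂ))) + C * (h y / (x + (y : ℂ)))) :
    IntegrableOn F (Ioi 0) ∧
      lam * ∫ y in Ioi (0 : ℝ), F y =
        A * (lam * ∫ y in Ioi (0 : ℝ), h y / ((y : ℂ) - 1)) +
          C * (lam * ∫ y in Ioi (0 : ℝ), h y / (x + (y : ℂ))) := by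
  have hA := hJ.const_mul A
  have hB := hone.const_mul B
  have hC := hx.const_mul C
  constructor
  · exact IntegrableOn.congr_fun ((hA.add hB).add hC) (fun y hy => (hF y hy).symm) measurableSet_Ioi
  · have hAB : Integrable (fun y : ℝ => A * (h y / ((y : ℂ) - 1)) + B * (h y / (1 + (y : ℂ))))
        (volume.restrict (Ioi 0)) := hA.add hB
    rw [setIntegral_congr_fun measurableSet_Ioi hF, integral_add hAB hC, integral_add hA hB,
      integral_const_mul, integral_const_mul, integral_const_mul]
    linear_combination B * h1

theorem stieltjes_equation_of_eigenfunction {h r : ℝ → ℂ} {c lam : ℂ} (h1 : h 1 = 0)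
    (hint : ∀ x : ℝ, 0 < x → IntegrableOn (fun y : ℝ => h y / ((x : ℂ) + (y : ℂ))) (Ioi 0))
    (heig : ∀ x : ℝ, 0 < x → lam * ∫ y in Ioi (0 : ℝ), h y / ((x : ℂ) + (y : ℂ)) = h x)
    (hJ : IntegrableOn (fun y : ℝ => h y / ((y : ℂ) - 1)) (Ioi 0))
    (hJ2 : c * (lam * ∫ y in Ioi (0 : ℝ), h y / ((y : ℂ) - 1)) = 2)
    (hr : ∀ y : ℝ, 0 < y → r y = c * h y / (1 - (y : ℂ) ^ 2))
    {x : ℝ} (hx : 0 < x) (hx1 : x ≠ 1) :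
    (IntegrableOn (fun y : ℝ => r y / ((x : ℂ) + (y : ℂ))) (Ioi 0) ∧
      r x = 1 / (1 + (x : ℂ)) + lam * ∫ y in Ioi (0 : ℝ), r y / ((x : ℂ) + (y : ℂ))) ∧
    (IntegrableOn (fun y : ℝ => (y : ℂ) ^ 2 * r y / ((x : ℂ) + (y : ℂ))) (Ioi 0) ∧
      (x : ℂ) ^ 2 * r x = 1 / (1 + (x : ℂ)) +
        lam * ∫ y in Ioi (0 : ℝ), (y : ℂ) ^ 2 * r y / ((x : ℂ) + (y : ℂ))) := by
  have hne : ∀ y : ℝ, 0 < y → (1 + (y : ℂ)) ≠ 0 := fun y hy => by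
    exact_mod_cast (by positivity : 1 + y ≠ 0)
  have hnx : ∀ y : ℝ, 0 < y → ((x : ℂ) + (y : ℂ)) ≠ 0 := fun y hy => by
    exact_mod_cast (by positivity : x + y ≠ 0)
  have hne' : ∀ y : ℝ, y ≠ 1 → ((y : ℂ) - 1) ≠ 0 := fun y hy =>
    sub_ne_zero.mpr (by exact_mod_cast hy)
  have hsq : ∀ y : ℝ, (1 - (y : ℂ) ^ 2) = -(((y : ℂ) - 1) * (1 + y)) := fun y => by ring
  have hone : IntegrableOn (fun y : ℝ => h y / (1 + (y : ℂ))) (Ioi 0) := by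
    simpa using hint 1 one_pos
  have heig1 : lam * ∫ y in Ioi (0 : ℝ), h y / (1 + (y : ℂ)) = 0 := by
    simpa [h1] using heig 1 one_pos
  have hxa := hne x hx
  have hxb := hne' x hx1
  have k2 := integral_partial_fractions (F := fun y : ℝ => r y / ((x : ℂ) + (y : ℂ)))
    (A := -c / (2 * (1 + x))) (B := c / (2 * (x - 1))) (C := c / (1 - (x : ℂ) ^ 2))
    hJ hone (hint x hx) heig1 (fun y hy => by
      rcases eq_or_ne y 1 with rfl | hy1
      · simp [hr, h1]
      have a1 := hne y hy
      have a2 := hne' y hy1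
      have a3 := hnx y hy
      rw [hr y hy, hsq, hsq]
      field_simp
      ring)
  have k3 := integral_partial_fractions
    (F := fun y : ℝ => (y : ℂ) ^ 2 * r y / ((x : ℂ) + (y : ℂ)))
    (A := -c / (2 * (1 + x))) (B := c / (2 * (x - 1)))
    (C := (x : ℂ) ^ 2 * c / (1 - (x : ℂ) ^ 2))
    hJ hone (hint x hx) heig1 (fun y hy => by
      rcases eq_or_ne y 1 with rfl | hy1
      · simp [hr, h1]
      have a1 := hne y hy
      have a2 := hne' y hy1
      have a3 := hnx y hy
      rw [hr y hy, hsq, hsq]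
      field_simp
      ring)
  have hA : -c / (2 * (1 + x)) * (lam * ∫ y in Ioi (0 : ℝ), h y / ((y : ℂ) - 1))
      = -(1 / (1 + (x : ℂ))) := by
    have : -c / (2 * (1 + x)) * (lam * ∫ y in Ioi (0 : ℝ), h y / ((y : ℂ) - 1))
      = -(c * (lam * ∫ y in Ioi (0 : ℝ), h y / ((y : ℂ) - 1))) / (2 * (1 + x)) := by ring
    rw [this, hJ2]
    field_simp
  refine ⟨⟨k2.1, ?_⟩, k3.1, ?_⟩
  · rw [k2.2, hA, heig x hx, hr x hx]
    ring
  · rw [k3.2, hA, heig x hx, hr x hx]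
    ring

theorem r2_eq_of_ne_half {α : ℂ} (hα : α ≠ 1 / 2) {y : ℝ} (hy : 0 < y) :
    r2 α y = (1 / Complex.cos (Real.pi * α)) * ((y : ℂ) ^ (-α) - (y : ℂ) ^ (α - 1)) /
      (1 - (y : ℂ) ^ 2) := by
  have hy' : (y : ℂ) ≠ 0 := by exact_mod_cast hy.ne'
  rw [r2, r1, if_neg (by simpa using hα), neg_neg, mul_neg, Complex.cos_neg,
    Complex.cpow_add _ _ hy', Complex.cpow_sub _ _ hy', Complex.cpow_one]
  field_simp
  ring

theorem r2_half_eq {y : ℝ} (hy : 0 < y) :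
    r2 (1 / 2) y = (2 / (Real.pi : ℂ)) * ((y : ℂ) ^ ((1 / 2 : ℂ) - 1) * Real.log y) /
      (1 - (y : ℂ) ^ 2) := by
  have hy' : (y : ℂ) ≠ 0 := by exact_mod_cast hy.ne'
  rw [r2, r1, if_pos rfl, Complex.cpow_sub _ _ hy', Complex.cpow_one]
  field_simp

theorem Complex.sin_pi_mul_ne_zero {α : ℂ} (h0 : 0 < α.re) (h1 : α.re < 1) :
    Complex.sin (Real.pi * α) ≠ 0 := by
  intro h
  obtain ⟨k, hk⟩ := Complex.sin_eq_zero_iff.mp h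
  have hα : α = k := mul_left_cancel₀ (Complex.ofReal_ne_zero.mpr Real.pi_ne_zero)
    (by rw [hk, mul_comm])
  rw [hα, Complex.intCast_re] at h0 h1
  have h0' : 0 < k := by exact_mod_cast h0
  have h1' : k < 1 := by exact_mod_cast h1
  omega

theorem Complex.cos_pi_mul_ne_zero {α : ℂ} (h0 : 0 < α.re) (h1 : α.re ≤ 1 / 2)
    (hα : α ≠ 1 / 2) : Complex.cos (Real.pi * α) ≠ 0 := by
  intro h
  obtain ⟨k, hk⟩ := Complex.cos_eq_zero_iff.mp h
  have hαk : α = (((2 * k + 1) / 2 : ℝ) : ℂ) :=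
    mul_left_cancel₀ (Complex.ofReal_ne_zero.mpr Real.pi_ne_zero)
      (by rw [hk]; push_cast; ring)
  rw [hαk, Complex.ofReal_re] at h0 h1
  have h0' : (-1 : ℝ) < 2 * k := by linarith
  have h1' : (k : ℝ) ≤ 0 := by linarith
  have h0'' : -1 < 2 * k := by exact_mod_cast h0'
  have h1'' : k ≤ 0 := by exact_mod_cast h1'
  obtain rfl : k = 0 := by omega
  exact hα (by rw [hαk]; simp)

theorem integrableOn_cpow_div_const_add {x : ℝ} (hx : 0 < x) {s : ℂ}
    (hs0 : 0 < s.re) (hs1 : s.re < 1) :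
    IntegrableOn (fun y : ℝ => (y : ℂ) ^ (s - 1) / ((x : ℂ) + y)) (Ioi 0) := by
  simpa only [MellinConvergent, smul_eq_mul, ← div_eq_mul_inv] using
    (mellin_inv_const_add_hasDerivAt hx hs0 hs1).1

theorem integral_cpow_div_const_add {x : ℝ} (hx : 0 < x) {s : ℂ}
    (hs0 : 0 < s.re) (hs1 : s.re < 1) :
    ∫ y in Ioi (0 : ℝ), (y : ℂ) ^ (s - 1) / ((x : ℂ) + y) =
      Real.pi / Complex.sin (Real.pi * s) * (x : ℂ) ^ (s - 1) := by
  simpa only [mellin, smul_eq_mul, ← div_eq_mul_inv] using mellin_inv_const_add hx hs0 hs1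

theorem integrableOn_cpow_mul_log_div_const_add {x : ℝ} (hx : 0 < x) {s : ℂ}
    (hs0 : 0 < s.re) (hs1 : s.re < 1) :
    IntegrableOn (fun y : ℝ => (y : ℂ) ^ (s - 1) * Real.log y / ((x : ℂ) + y)) (Ioi 0) := by
  simpa only [MellinConvergent, smul_eq_mul, Complex.real_smul, div_eq_mul_inv,
    mul_assoc] using (mellin_inv_const_add_hasDerivAt hx hs0 hs1).2.1

theorem integral_cpow_half_mul_log_div_const_add {x : ℝ} (hx : 0 < x) :
    ∫ y in Ioi (0 : ℝ), (y : ℂ) ^ ((1 / 2 : ℂ) - 1) * Real.log y / ((x : ℂ) + y) =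
      Real.pi * ((x : ℂ) ^ ((1 / 2 : ℂ) - 1) * Complex.log x) := by
  have hx' : (x : ℂ) ≠ 0 := by exact_mod_cast hx.ne'
  have hd := (mellin_inv_const_add_hasDerivAt hx (s := 1 / 2) (by norm_num) (by norm_num)).2.2
  have hsin : Complex.sin (Real.pi * (1 / 2 : ℂ)) = 1 := by
    rw [mul_one_div, Complex.sin_pi_div_two]
  have hcos : Complex.cos (Real.pi * (1 / 2 : ℂ)) = 0 := by
    rw [mul_one_div, Complex.cos_pi_div_two]
  have h1 : HasDerivAt (fun s : ℂ => Real.pi / Complex.sin (Real.pi * s)) 0 (1 / 2) := by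
    have := (hasDerivAt_const (1 / 2 : ℂ) (Real.pi : ℂ)).div
      (((hasDerivAt_id (1 / 2 : ℂ)).const_mul (Real.pi : ℂ)).csin)
      (by simp only [id]; rw [hsin]; exact one_ne_zero)
    convert! this using 1
    simp only [id]
    rw [hcos]
    simp
  have h2 : HasDerivAt (fun s : ℂ => (x : ℂ) ^ (s - 1))
      ((x : ℂ) ^ ((1 / 2 : ℂ) - 1) * Complex.log x * 1) (1 / 2) :=
    ((hasDerivAt_id (1 / 2 : ℂ)).sub_const 1).const_cpow (Or.inl hx')
  have hev : (mellin fun t : ℝ => ((x : ℂ) + t)⁻¹) =ᶠ[nhds (1 / 2)]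
      fun s => Real.pi / Complex.sin (Real.pi * s) * (x : ℂ) ^ (s - 1) := by
    filter_upwards [(isOpen_lt continuous_const Complex.continuous_re).mem_nhds
      (show (0 : ℝ) < (1 / 2 : ℂ).re by norm_num),
      (isOpen_lt Complex.continuous_re continuous_const).mem_nhds
      (show (1 / 2 : ℂ).re < (1 : ℝ) by norm_num)] with s hs0 hs1
    exact mellin_inv_const_add hx hs0 hs1
  have := (hd.congr_of_eventuallyEq hev.symm).unique (h1.mul h2)
  rw [hsin] at this
  simpa only [mellin, smul_eq_mul, Complex.real_smul, div_eq_mul_inv, mul_assoc, zero_mul,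
    zero_add, inv_one, one_mul, mul_one] using this

theorem tendsto_cpow_neg_one (s : ℂ) :
    Filter.Tendsto (fun z : ℂ => z ^ s) (nhdsWithin (-1) {z : ℂ | 0 ≤ z.im})
      (nhds (Complex.exp (Real.pi * Complex.I * s))) := by
  have hlog := Complex.tendsto_log_nhdsWithin_im_nonneg_of_re_neg_of_im_zero (z := -1)
    (by simp) (by simp)
  simp only [norm_neg, norm_one, Real.log_one, Complex.ofReal_zero, zero_add] at hlog
  refine ((Complex.continuous_exp.tendsto _).comp (hlog.mul_const s)).congr' ?_
  filter_upwards [nhdsWithin_le_nhds (isOpen_ne.mem_nhds (show (-1 : ℂ) ≠ 0 by simp))] with z hz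
  rw [Complex.cpow_def_of_ne_zero hz]
  rfl

theorem differentiableOn_cpow_const (s : ℂ) :
    DifferentiableOn ℂ (fun z : ℂ => z ^ s) Complex.slitPlane := fun _ hz =>
  (differentiableAt_id.cpow_const hz).differentiableWithinAt

theorem hasDerivAt_ofReal_cpow_one (s : ℂ) : HasDerivAt (fun y : ℝ => (y : ℂ) ^ s) s 1 := by
  have h : HasDerivAt (fun z : ℂ => z ^ s) s ((1 : ℝ) : ℂ) := by
    have := (hasDerivAt_id ((1 : ℝ) : ℂ)).cpow_const (c := s) (by simp)
    simpa using this
  exact h.comp_ofReal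

/-- `r₂(·;α)` and `r₃(·;α)` satisfy the Stieltjes equation with
`g(x) = 1/(1+x)`, for `0 < Re α ≤ 1/2`, `λ = sin(πα)/π`. -/
theorem stmt4 (α : ℂ) (hα1 : 0 < α.re) (hα2 : α.re ≤ 1/2)
    (lam : ℂ) (hlam : lam = Complex.sin ((Real.pi : ℂ) * α) / (Real.pi : ℂ)) :
    ∀ x : ℝ, 0 < x → x ≠ 1 →
      (IntegrableOn (fun y : ℝ => r2 α y / ((x : ℂ) + (y : ℂ))) (Ioi 0) ∧
        r2 α x = 1 / (1 + (x : ℂ)) + lam * ∫ y in Ioi (0 : ℝ), r2 α y / ((x : ℂ) + (y : ℂ))) ∧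
      (IntegrableOn (fun y : ℝ => r3 α y / ((x : ℂ) + (y : ℂ))) (Ioi 0) ∧
        r3 α x = 1 / (1 + (x : ℂ)) + lam * ∫ y in Ioi (0 : ℝ), r3 α y / ((x : ℂ) + (y : ℂ))) := by
  intro x hx hx1
  have hpi : (Real.pi : ℂ) ≠ 0 := Complex.ofReal_ne_zero.mpr Real.pi_ne_zero
  by_cases hα : α = 1 / 2
  · subst hα
    have hsin : Complex.sin (Real.pi * (1 / 2 : ℂ)) = 1 := by
      rw [mul_one_div, Complex.sin_pi_div_two]
    rw [hsin] at hlam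
    have hint : ∀ x : ℝ, 0 < x → IntegrableOn
        (fun y : ℝ => (y : ℂ) ^ ((1 / 2 : ℂ) - 1) * Real.log y / ((x : ℂ) + y)) (Ioi 0) :=
      fun x hx => integrableOn_cpow_mul_log_div_const_add hx (by norm_num) (by norm_num)
    have hone := hint 1 one_pos
    rw [Complex.ofReal_one] at hone
    have hd : HasDerivAt (fun y : ℝ => (y : ℂ) ^ ((1 / 2 : ℂ) - 1) * Real.log y) _ 1 :=
      (hasDerivAt_ofReal_cpow_one _).mul (Real.hasDerivAt_log one_ne_zero).ofReal_comp
    have hJ := integral_div_sub_one_eq hone hd (by simp)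
      (G := fun z => Real.pi * (z ^ ((1 / 2 : ℂ) - 1) * Complex.log z))
      (((differentiableOn_cpow_const _).mul fun z hz =>
        (Complex.differentiableAt_log hz).differentiableWithinAt).const_mul _)
      (fun x hx => integral_cpow_half_mul_log_div_const_add hx)
      (((tendsto_cpow_neg_one _).mul
        (Complex.tendsto_log_nhdsWithin_im_nonneg_of_re_neg_of_im_zero
          (by simp) (by simp))).const_mul _)
    refine stieltjes_equation_of_eigenfunction (c := 2 / Real.pi)
      (h := fun y : ℝ => (y : ℂ) ^ ((1 / 2 : ℂ) - 1) * Real.log y) (by simp) hint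
      (fun x hx => ?_) (integrableOn_div_sub_one hone hd (by simp)) ?_
      (fun y hy => r2_half_eq hy) hx hx1
    · rw [integral_cpow_half_mul_log_div_const_add hx, hlam, Complex.ofReal_log hx.le]
      field_simp
    · have hexp : Complex.exp (Real.pi * Complex.I * ((1 / 2 : ℂ) - 1)) = -Complex.I := by
        rw [← Complex.exp_neg_pi_div_two_mul_I]
        congr 1
        ring
      rw [hJ, hexp, hlam]
      simp only [norm_neg, norm_one, Real.log_one, Complex.ofReal_zero, zero_add]
      field_simp
      simp
  · have hs := Complex.sin_pi_mul_ne_zero hα1 (by linarith)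
    have hc := Complex.cos_pi_mul_ne_zero hα1 hα2 hα
    have hs' : Complex.sin (Real.pi * (1 - α)) = Complex.sin (Real.pi * α) := by
      rw [mul_sub, mul_one, Complex.sin_pi_sub]
    have e : (1 - α) - 1 = -α := by ring
    have ha0 : 0 < (1 - α).re := by simp; linarith
    have ha1 : (1 - α).re < 1 := by simpa using hα1
    have hb1 : α.re < 1 := by linarith
    have hi1 : ∀ x : ℝ, 0 < x →
        IntegrableOn (fun y : ℝ => (y : ℂ) ^ (-α) / ((x : ℂ) + y)) (Ioi 0) :=
      fun x hx => by simpa only [e] using integrableOn_cpow_div_const_add hx ha0 ha1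
    have hi2 := fun (x : ℝ) (hx : 0 < x) => integrableOn_cpow_div_const_add hx hα1 hb1
    have hint : ∀ x : ℝ, 0 < x → IntegrableOn
        (fun y : ℝ => ((y : ℂ) ^ (-α) - (y : ℂ) ^ (α - 1)) / ((x : ℂ) + y)) (Ioi 0) :=
      fun x hx => by
        simp only [sub_div]
        exact (hi1 x hx).sub (hi2 x hx)
    have hval : ∀ x : ℝ, 0 < x →
        ∫ y in Ioi (0 : ℝ), ((y : ℂ) ^ (-α) - (y : ℂ) ^ (α - 1)) / ((x : ℂ) + y) =
          Real.pi / Complex.sin (Real.pi * α) * ((x : ℂ) ^ (-α) - (x : ℂ) ^ (α - 1)) := by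
      intro x hx
      have h1 := integral_cpow_div_const_add hx ha0 ha1
      simp only [e, hs'] at h1
      simp only [sub_div]
      rw [integral_sub (hi1 x hx) (hi2 x hx), h1, integral_cpow_div_const_add hx hα1 hb1]
      ring
    have hone := hint 1 one_pos
    rw [Complex.ofReal_one] at hone
    have hd := (hasDerivAt_ofReal_cpow_one (-α)).sub (hasDerivAt_ofReal_cpow_one (α - 1))
    have hJ := integral_div_sub_one_eq hone hd (by simp)
      (G := fun z => Real.pi / Complex.sin (Real.pi * α) * (z ^ (-α) - z ^ (α - 1)))
      (((differentiableOn_cpow_const _).sub (differentiableOn_cpow_const _)).const_mul _)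
      hval (((tendsto_cpow_neg_one _).sub (tendsto_cpow_neg_one _)).const_mul _)
    refine stieltjes_equation_of_eigenfunction (c := 1 / Complex.cos (Real.pi * α))
      (h := fun y : ℝ => (y : ℂ) ^ (-α) - (y : ℂ) ^ (α - 1)) (by simp) hint
      (fun x hx => ?_) (integrableOn_div_sub_one hone hd (by simp)) ?_
      (fun y hy => r2_eq_of_ne_half hα hy) hx hx1
    · rw [hval x hx, hlam]
      field_simp
    · have hexp : Complex.exp (Real.pi * Complex.I * -α) -
          Complex.exp (Real.pi * Complex.I * (α - 1)) = 2 * Complex.cos (Real.pi * α) := by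
        have e1 : (Real.pi * Complex.I * (α - 1) : ℂ) =
          Real.pi * α * Complex.I - Real.pi * Complex.I := by ring
        have e2 : (Real.pi * Complex.I * -α : ℂ) = -(Real.pi * α) * Complex.I := by ring
        rw [e1, e2, Complex.exp_sub, Complex.exp_pi_mul_I, Complex.two_cos]
        ring
      rw [hJ, hexp, hlam]
      field_simp

end
end

section
/- Let α ∈ ℂ with -1/2 ≤ Re α < 0. Then ∫₀^∞ max(1, x^{-1})·|r₁(x;α)| dx < ∞. -/
open MeasureTheory Set Asymptotics

noncomputable section

/-- A `C¹` numerator vanishing at `1`, of size `O(x ^ a)` at `0` with `a > 0` and `O(x ^ b)` at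
infinity with `b < 1`, gives an integrable quotient by `1 - x ^ 2` for the weight `max 1 x⁻¹`. -/
theorem integrableOn_max_one_inv_mul_norm_div {N : ℝ → ℂ} {a b C : ℝ}
    (hN : ContDiffOn ℝ 1 N (Ioi 0)) (hN1 : N 1 = 0) (ha : 0 < a) (hb : b < 1)
    (h0 : ∀ x : ℝ, 0 < x → x ≤ 1 → ‖N x‖ ≤ C * x ^ a)
    (h1 : ∀ x : ℝ, 1 ≤ x → ‖N x‖ ≤ C * x ^ b) :
    IntegrableOn (fun x : ℝ => max 1 x⁻¹ * ‖N x / (1 - (x : ℂ) ^ 2)‖) (Ioi 0) := by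
  have hden : ∀ x : ℝ, ‖(1 - (x : ℂ) ^ 2)‖ = |1 - x ^ 2| := fun x => by
    rw [← Complex.ofReal_one, ← Complex.ofReal_pow, ← Complex.ofReal_sub, Complex.norm_real,
      Real.norm_eq_abs]
  have hmeas : AEStronglyMeasurable (fun x : ℝ => max 1 x⁻¹ * ‖N x / (1 - (x : ℂ) ^ 2)‖)
      (volume.restrict (Ioi 0)) := by
    have hNm : AEMeasurable N (volume.restrict (Ioi 0)) :=
      hN.continuousOn.aemeasurable measurableSet_Ioi
    have hd : Measurable (fun x : ℝ => (1 - (x : ℂ) ^ 2)) := by fun_prop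
    have hm : Measurable (fun x : ℝ => max 1 x⁻¹) := measurable_const.max measurable_inv
    exact (hm.aemeasurable.mul (hNm.div hd.aemeasurable).norm).aestronglyMeasurable
  have hunion : (Ioi 0 : Set ℝ) = Ioc 0 (1/2) ∪ Icc (1/2) 2 ∪ Ioi 2 := by
    ext x
    simp only [mem_Ioi, mem_union, mem_Ioc, mem_Icc]
    constructor
    · intro hx
      rcases le_total x (1/2) with h | h
      · exact Or.inl (Or.inl ⟨hx, h⟩)
      · rcases le_or_gt x 2 with h' | h'
        · exact Or.inl (Or.inr ⟨h, h'⟩)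
        · exact Or.inr h'
    · rintro ((h | h) | h) <;> linarith
  have hC : 0 ≤ C := by simpa [hN1] using h0 1 one_pos le_rfl
  have hnear : IntegrableOn (fun x : ℝ => max 1 x⁻¹ * ‖N x / (1 - (x : ℂ) ^ 2)‖)
      (Ioc 0 (1/2)) := by
    have hg : IntegrableOn (fun x : ℝ => 2 * C * x ^ (a - 1)) (Ioc 0 (1/2)) := by
      have := intervalIntegral.intervalIntegrable_rpow' (a := 0) (b := 1/2) (r := a - 1)
        (by linarith)
      rw [intervalIntegrable_iff_integrableOn_Ioc_of_le (by norm_num)] at this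
      exact this.const_mul _
    refine Integrable.mono' hg (hmeas.mono_set fun x hx => hx.1) ?_
    filter_upwards [ae_restrict_mem measurableSet_Ioc] with x hx
    obtain ⟨hx0, hx2⟩ := hx
    have hinv : 1 ≤ x⁻¹ := (one_le_inv₀ hx0).2 (by linarith)
    have hq : 1 / 2 ≤ |1 - x ^ 2| := le_trans (by nlinarith) (le_abs_self _)
    rw [Real.norm_of_nonneg (by positivity), max_eq_right hinv, norm_div, hden,
      Real.rpow_sub_one hx0.ne']
    calc x⁻¹ * (‖N x‖ / |1 - x ^ 2|) ≤ x⁻¹ * (C * x ^ a / (1 / 2)) := by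
          gcongr
          exact h0 x hx0 (by linarith)
      _ = 2 * C * (x ^ a / x) := by ring
  have hmid : IntegrableOn (fun x : ℝ => max 1 x⁻¹ * ‖N x / (1 - (x : ℂ) ^ 2)‖)
      (Icc (1/2) 2) := by
    have hsub : Icc (1/2 : ℝ) 2 ⊆ Ioi 0 := fun x hx => lt_of_lt_of_le (by norm_num) hx.1
    obtain ⟨K, hK⟩ := (hN.mono hsub).exists_lipschitzOnWith one_ne_zero (convex_Icc _ _)
      isCompact_Icc
    have hg : IntegrableOn (fun _ : ℝ => 2 * (K : ℝ)) (Icc (1/2) 2) :=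
      continuous_const.integrableOn_Icc
    refine Integrable.mono' hg (hmeas.mono_set hsub) ?_
    filter_upwards [ae_restrict_mem measurableSet_Icc] with x hx
    have hx0 : 0 < x := hsub hx
    have hmax : max 1 x⁻¹ ≤ 2 :=
      max_le one_le_two ((inv_le_comm₀ hx0 two_pos).2 (by simpa using hx.1))
    have hlip : ‖N x‖ ≤ K * |1 - x| := by
      have := hK.dist_le_mul x hx 1 ⟨by norm_num, by norm_num⟩
      rwa [dist_eq_norm, hN1, sub_zero, Real.dist_eq, abs_sub_comm] at this
    have hq : |1 - x| ≤ |1 - x ^ 2| := by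
      rw [show 1 - x ^ 2 = (1 - x) * (1 + x) by ring, abs_mul]
      exact le_mul_of_one_le_right (abs_nonneg _) (by rw [abs_of_pos] <;> linarith)
    rw [Real.norm_of_nonneg (by positivity), norm_div, hden]
    have hquot : ‖N x‖ / |1 - x ^ 2| ≤ K :=
      div_le_of_le_mul₀ (abs_nonneg _) K.coe_nonneg
        (hlip.trans (mul_le_mul_of_nonneg_left hq K.coe_nonneg))
    exact mul_le_mul hmax hquot (by positivity) zero_le_two
  have hfar : IntegrableOn (fun x : ℝ => max 1 x⁻¹ * ‖N x / (1 - (x : ℂ) ^ 2)‖) (Ioi 2) := by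
    have hg : IntegrableOn (fun x : ℝ => 2 * C * x ^ (b - 2)) (Ioi 2) :=
      (integrableOn_Ioi_rpow_of_lt (by linarith) two_pos).const_mul _
    refine Integrable.mono' hg (hmeas.mono_set (Ioi_subset_Ioi zero_le_two)) ?_
    filter_upwards [ae_restrict_mem measurableSet_Ioi] with x hx
    have hx2 : 2 < x := hx
    have hx0 : 0 < x := by linarith
    have hinv : x⁻¹ ≤ 1 := inv_le_one_of_one_le₀ (by linarith)
    have hq : x ^ 2 / 2 ≤ |1 - x ^ 2| := le_trans (by nlinarith) (neg_le_abs _)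
    rw [Real.norm_of_nonneg (by positivity), max_eq_left hinv, norm_div, hden,
      Real.rpow_sub hx0, Real.rpow_two, one_mul]
    calc ‖N x‖ / |1 - x ^ 2| ≤ C * x ^ b / (x ^ 2 / 2) := by
          gcongr
          exact h1 x (by linarith)
      _ = 2 * C * (x ^ b / x ^ 2) := by ring
  rw [hunion]
  exact (hnear.union hmid).union hfar

theorem contDiffOn_ofReal_cpow_const (c : ℂ) :
    ContDiffOn ℝ 1 (fun x : ℝ => (x : ℂ) ^ c) (Ioi 0) := by
  have hexp : ContDiffOn ℝ 1 (fun x : ℝ => Complex.exp ((Real.log x : ℂ) * c)) (Ioi 0) := by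
    have hlog : ContDiffOn ℝ 1 Real.log (Ioi 0) :=
      Real.contDiffOn_log.mono fun x hx => (ne_of_gt hx : x ≠ 0)
    exact ((Complex.ofRealCLM.contDiff.comp_contDiffOn hlog).mul contDiffOn_const).cexp
  refine hexp.congr fun x hx => ?_
  have hx0 : (0 : ℝ) < x := hx
  rw [Complex.cpow_def_of_ne_zero (by exact_mod_cast hx0.ne'), Complex.ofReal_log hx0.le]

theorem integrableOn_max_one_inv_mul_norm_cpow_sub {α : ℂ} (hα1 : -(1/2) ≤ α.re)
    (hα2 : α.re < 0) :
    IntegrableOn (fun x : ℝ =>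
      max 1 x⁻¹ * ‖((x : ℂ) ^ (-α) - (x : ℂ) ^ (α + 1)) / (1 - (x : ℂ) ^ 2)‖) (Ioi 0) := by
  have hnorm : ∀ x : ℝ, 0 < x →
      ‖(x : ℂ) ^ (-α) - (x : ℂ) ^ (α + 1)‖ ≤ x ^ (-α.re) + x ^ (α.re + 1) := fun x hx => by
    refine (norm_sub_le _ _).trans_eq ?_
    rw [Complex.norm_cpow_eq_rpow_re_of_pos hx, Complex.norm_cpow_eq_rpow_re_of_pos hx]
    simp
  refine integrableOn_max_one_inv_mul_norm_div (a := -α.re) (b := α.re + 1) (C := 2)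
    ((contDiffOn_ofReal_cpow_const _).sub (contDiffOn_ofReal_cpow_const _)) (by simp)
    (by linarith) (by linarith) (fun x hx hx1 => ?_) fun x hx => ?_
  · have := Real.rpow_le_rpow_of_exponent_ge hx hx1 (show -α.re ≤ α.re + 1 by linarith)
    linarith [hnorm x hx]
  · have := Real.rpow_le_rpow_of_exponent_le hx (show -α.re ≤ α.re + 1 by linarith)
    linarith [hnorm x (by linarith)]

theorem integrableOn_max_one_inv_mul_norm_sqrt_mul_log :
    IntegrableOn (fun x : ℝ =>
      max 1 x⁻¹ * ‖((x : ℂ) ^ ((1 : ℂ)/2) * (Real.log x : ℂ)) / (1 - (x : ℂ) ^ 2)‖) (Ioi 0) := by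
  have hnorm : ∀ x : ℝ, 0 < x →
      ‖(x : ℂ) ^ ((1 : ℂ)/2) * (Real.log x : ℂ)‖ = x ^ (1/2 : ℝ) * |Real.log x| := fun x hx => by
    rw [norm_mul, Complex.norm_cpow_eq_rpow_re_of_pos hx, Complex.norm_real, Real.norm_eq_abs]
    norm_num
  have hlog : ContDiffOn ℝ 1 Real.log (Ioi 0) :=
    Real.contDiffOn_log.mono fun x hx => (ne_of_gt hx : x ≠ 0)
  refine integrableOn_max_one_inv_mul_norm_div (a := 1/4) (b := 3/4) (C := 4)
    ((contDiffOn_ofReal_cpow_const _).mul (Complex.ofRealCLM.contDiff.comp_contDiffOn hlog))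
    (by simp) (by norm_num) (by norm_num) (fun x hx hx1 => ?_) fun x hx => ?_
  · have h := Real.abs_log_mul_self_rpow_lt x (1/4) hx hx1 (by norm_num)
    rw [abs_mul, abs_of_pos (Real.rpow_pos_of_pos hx _)] at h
    rw [hnorm x hx, show (1/2 : ℝ) = 1/4 + 1/4 by norm_num, Real.rpow_add hx]
    nlinarith [Real.rpow_pos_of_pos hx (1/4)]
  · have hx0 : 0 < x := by linarith
    have h := Real.log_le_rpow_div hx0.le (show (0 : ℝ) < 1/4 by norm_num)
    rw [hnorm x hx0, abs_of_nonneg (Real.log_nonneg hx),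
      show (3/4 : ℝ) = 1/2 + 1/4 by norm_num, Real.rpow_add hx0]
    nlinarith [Real.rpow_pos_of_pos hx0 (1/2)]

/-- for `-1/2 ≤ Re α < 0`, `∫₀^∞ max(1, x⁻¹)|r₁(x;α)| dx < ∞`. -/
theorem stmt5 (α : ℂ) (hα1 : -(1/2) ≤ α.re) (hα2 : α.re < 0) :
    IntegrableOn (fun x : ℝ => max 1 x⁻¹ * ‖r1 α x‖) (Ioi 0) := by
  by_cases hα : α = -(1/2 : ℂ)
  · refine (integrableOn_max_one_inv_mul_norm_sqrt_mul_log.const_mul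
      ‖-(2 / (Real.pi : ℂ))‖).congr (Filter.Eventually.of_forall fun x => ?_)
    simp only [r1, if_pos hα]
    rw [mul_div_assoc (-(2 / (Real.pi : ℂ))), norm_mul (-(2 / (Real.pi : ℂ)))]
    exact mul_left_comm _ _ _
  · refine ((integrableOn_max_one_inv_mul_norm_cpow_sub hα1 hα2).const_mul
      ‖1 / Complex.cos ((Real.pi : ℂ) * α)‖).congr (Filter.Eventually.of_forall fun x => ?_)
    simp only [r1, if_neg hα]
    rw [norm_mul]
    ring

end
end
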